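/- Let f : Ω → Ω' be a quasiconformal homeomorphism between domains in ℝ^n, n ≥ 2, and assume f ∈ W^{1,p}_loc(Ω : ℝ^n) for some p > n. Let E ⊆ Ω be a closed set (in Ω) of vanishing s-capacity in Ω for some 0 < s < n. Then f(E) has vanishing r-capacity in Ω' for all 0 < r ≤ s(p−n)/(p−s). -/

import Mathlib

open Set Filter MeasureTheory Metric Topology
open scoped ENNReal NNReal

noncomputable section

/-- The maximal stretch `L_f(x,r) = sup {dist (f y) (f x) : y ∈ Ω, dist y x = r}`. -/
def maxStretch {X Y : Type*} [MetricSpace X] [MetricSpace Y]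
    (Ω : Set X) (f : X → Y) (x : X) (r : ℝ) : ℝ :=
  sSup ((fun y => dist (f y) (f x)) '' {y ∈ Ω | dist y x = r})

/-- The minimal stretch `ℓ_f(x,r) = inf {dist (f y) (f x) : y ∈ Ω, dist y x = r}`. -/
def minStretch {X Y : Type*} [MetricSpace X] [MetricSpace Y]
    (Ω : Set X) (f : X → Y) (x : X) (r : ℝ) : ℝ :=
  sInf ((fun y => dist (f y) (f x)) '' {y ∈ Ω | dist y x = r})

/-- `f` is a homeomorphism of `Ω` onto `Ω'`. -/
def IsHomeoOn {X Y : Type*} [TopologicalSpace X] [TopologicalSpace Y]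
    (f : X → Y) (Ω : Set X) (Ω' : Set Y) : Prop :=
  Set.BijOn f Ω Ω' ∧ ContinuousOn f Ω ∧
    ∃ g : Y → X, Set.InvOn g f Ω Ω' ∧ ContinuousOn g Ω'

/-- `f : Ω → Ω'` is a `K`-quasiconformal homeomorphism:
it is a homeomorphism of `Ω` onto `Ω'` and
`limsup_{r → 0⁺} L_f(x,r)/ℓ_f(x,r) ≤ K` for every `x ∈ Ω`. -/
def IsQCHomeoOn {X Y : Type*} [MetricSpace X] [MetricSpace Y]
    (K : ℝ) (f : X → Y) (Ω : Set X) (Ω' : Set Y) : Prop :=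
  IsHomeoOn f Ω Ω' ∧
    ∀ x ∈ Ω, Filter.limsup (fun r => maxStretch Ω f x r / minStretch Ω f x r)
      (𝓝[>] (0:ℝ)) ≤ K

/-- A domain: a nonempty open connected set. -/
def IsEuclDomain {X : Type*} [TopologicalSpace X] (Ω : Set X) : Prop :=
  IsOpen Ω ∧ IsConnected Ω

/-- A continuous map `f` belongs to `W^{1,p}(Ω : ℝ^N)`: there is a locally integrable
weak derivative `Df : Ω → (ℝ^n →L ℝ^N)` with `∫_Ω ‖Df‖^p < ∞`. -/
def MemW1p (n N : ℕ) (p : ℝ) (Ω : Set (EuclideanSpace ℝ (Fin n)))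
    (f : EuclideanSpace ℝ (Fin n) → EuclideanSpace ℝ (Fin N)) : Prop :=
  ∃ Df : EuclideanSpace ℝ (Fin n) → (EuclideanSpace ℝ (Fin n) →L[ℝ] EuclideanSpace ℝ (Fin N)),
    LocallyIntegrableOn Df Ω volume ∧
    (∫⁻ x in Ω, ENNReal.ofReal (‖Df x‖ ^ p) ∂volume) < ⊤ ∧
    ∀ φ : EuclideanSpace ℝ (Fin n) → ℝ, ContDiff ℝ (⊤ : ℕ∞) φ → HasCompactSupport φ →
      tsupport φ ⊆ Ω → ∀ v : EuclideanSpace ℝ (Fin n),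
        (∫ x in Ω, (fderiv ℝ φ x v) • f x ∂volume) = - ∫ x in Ω, (φ x) • (Df x v) ∂volume

/-- `f ∈ W^{1,p}_loc(Ω : ℝ^N)`: the restriction of `f` to every open set compactly
contained in `Ω` belongs to `W^{1,p}`. -/
def MemW1pLoc (n N : ℕ) (p : ℝ) (Ω : Set (EuclideanSpace ℝ (Fin n)))
    (f : EuclideanSpace ℝ (Fin n) → EuclideanSpace ℝ (Fin N)) : Prop :=
  ∀ U : Set (EuclideanSpace ℝ (Fin n)), IsOpen U → IsCompact (closure U) →
    closure U ⊆ Ω → MemW1p n N p U f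

/-- The variational `s`-Sobolev capacity of `E` in `Ω`: the infimum of `∫_Ω ‖∇u‖^s`
over smooth compactly supported `u : Ω → ℝ` equal to `1` on a neighborhood of `E`. -/
def sobCap (n : ℕ) (s : ℝ) (E Ω : Set (EuclideanSpace ℝ (Fin n))) : ℝ≥0∞ :=
  sInf { m : ℝ≥0∞ | ∃ u : EuclideanSpace ℝ (Fin n) → ℝ, ContDiff ℝ (⊤ : ℕ∞) u ∧
    HasCompactSupport u ∧ tsupport u ⊆ Ω ∧
    (∃ V, IsOpen V ∧ E ⊆ V ∧ ∀ x ∈ V, u x = 1) ∧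
    m = ∫⁻ x in Ω, ENNReal.ofReal (‖fderiv ℝ u x‖ ^ s) ∂volume }

/-- A closed set `E ⊆ Ω` has vanishing `s`-capacity in `Ω` if `s-Cap(E',U') = 0` for every
compact `E' ⊆ E` and every open `U' ⊆ Ω` containing `E'`. -/
def VanishingCap (n : ℕ) (s : ℝ) (E Ω : Set (EuclideanSpace ℝ (Fin n))) : Prop :=
  ∀ E' ⊆ E, IsCompact E' → ∀ U' : Set (EuclideanSpace ℝ (Fin n)),
    IsOpen U' → U' ⊆ Ω → E' ⊆ U' → sobCap n s E' U' = 0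

/-- The half-open dyadic cube of side length `2 ^ (-k)` containing `x`. -/
def dyadicCell {n : ℕ} (k : ℕ) (x : EuclideanSpace ℝ (Fin n)) : Set (EuclideanSpace ℝ (Fin n)) :=
  {y | ∀ i, ⌊(2 : ℝ) ^ k * y i⌋ = ⌊(2 : ℝ) ^ k * x i⌋}

section DyadicCell

variable {n : ℕ} {k j : ℕ} {x y : EuclideanSpace ℝ (Fin n)}

lemma mem_dyadicCell_self : x ∈ dyadicCell k x := fun _ => rfl

lemma dyadicCell_eq_of_mem (h : y ∈ dyadicCell k x) : dyadicCell k y = dyadicCell k x := by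
  ext z
  exact forall_congr' fun i => by rw [h i]

lemma dyadicCell_succ_subset : dyadicCell (k + 1) x ⊆ dyadicCell k x := by
  intro y hy i
  have key : ∀ t : ℝ, ⌊(2 : ℝ) ^ k * t⌋ = ⌊(2 : ℝ) ^ (k + 1) * t⌋ / 2 := by
    intro t
    have h1 := Int.floor_le ((2 : ℝ) ^ (k + 1) * t)
    have h2 := Int.lt_floor_add_one ((2 : ℝ) ^ (k + 1) * t)
    have h3 := Int.floor_le ((2 : ℝ) ^ k * t)
    have h4 := Int.lt_floor_add_one ((2 : ℝ) ^ k * t)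
    rw [pow_succ] at h1 h2 ⊢
    have h5 : ⌊(2 : ℝ) ^ k * 2 * t⌋ < 2 * ⌊(2 : ℝ) ^ k * t⌋ + 2 := by
      have : (⌊(2 : ℝ) ^ k * 2 * t⌋ : ℝ) < ((2 * ⌊(2 : ℝ) ^ k * t⌋ + 2 : ℤ) : ℝ) := by
        push_cast; linarith
      exact_mod_cast this
    have h6 : 2 * ⌊(2 : ℝ) ^ k * t⌋ < ⌊(2 : ℝ) ^ k * 2 * t⌋ + 1 := by
      have : ((2 * ⌊(2 : ℝ) ^ k * t⌋ : ℤ) : ℝ) < ((⌊(2 : ℝ) ^ k * 2 * t⌋ + 1 : ℤ) : ℝ) := by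
        push_cast; linarith
      exact_mod_cast this
    omega
  rw [key, key, hy i]

lemma dyadicCell_anti (h : j ≤ k) : dyadicCell k x ⊆ dyadicCell j x := by
  induction k, h using Nat.le_induction with
  | base => exact subset_rfl
  | succ k _ ih => exact dyadicCell_succ_subset.trans ih

lemma dyadicCell_eq_preimage : dyadicCell k x =
    (MeasurableEquiv.toLp 2 (Fin n → ℝ)).symm ⁻¹' (univ.pi fun i =>
      Ico ((⌊(2 : ℝ) ^ k * x i⌋ : ℝ) / 2 ^ k) ((⌊(2 : ℝ) ^ k * x i⌋ + 1 : ℝ) / 2 ^ k)) := by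
  ext y
  simp only [dyadicCell, mem_ofPred_eq, mem_preimage, mem_univ_pi, mem_Ico]
  refine forall_congr' fun i => ?_
  have h2 : (0 : ℝ) < 2 ^ k := by positivity
  rw [Int.floor_eq_iff, div_le_iff₀ h2, lt_div_iff₀ h2, mul_comm _ (y i)]
  rfl

lemma measurableSet_dyadicCell : MeasurableSet (dyadicCell k x) := by
  rw [dyadicCell_eq_preimage]
  exact (MeasurableSet.univ_pi fun i => measurableSet_Ico).preimage (MeasurableEquiv.measurable _)

lemma volume_dyadicCell : volume (dyadicCell k x) = ENNReal.ofReal (((2 : ℝ) ^ k)⁻¹ ^ n) := by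
  rw [dyadicCell_eq_preimage,
    (EuclideanSpace.volume_preserving_symm_measurableEquiv_toLp (Fin n)).measure_preimage
      (MeasurableSet.univ_pi fun i => measurableSet_Ico).nullMeasurableSet, volume_pi_pi]
  simp only [Real.volume_Ico, ← sub_div, add_sub_cancel_left, one_div, Finset.prod_const,
    Finset.card_univ, Fintype.card_fin]
  rw [ENNReal.ofReal_pow (by positivity)]

lemma volume_real_dyadicCell : volume.real (dyadicCell k x) = ((2 : ℝ) ^ k)⁻¹ ^ n := by
  rw [Measure.real, volume_dyadicCell, ENNReal.toReal_ofReal (by positivity)]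

lemma convex_dyadicCell : Convex ℝ (dyadicCell k x) := by
  rw [dyadicCell_eq_preimage]
  exact (convex_pi fun i _ => convex_Ico _ _).linear_preimage
    (WithLp.linearEquiv 2 ℝ (Fin n → ℝ)).toLinearMap

lemma EuclideanSpace.dist_le_mul_of_forall {a : ℝ} (h : ∀ i, |y i - x i| ≤ a) :
    dist y x ≤ n * a := by
  rw [EuclideanSpace.dist_eq]
  rcases n.eq_zero_or_pos with rfl | hn
  · simp
  have ha : 0 ≤ a := (abs_nonneg _).trans (h ⟨0, hn⟩)
  calc √(∑ i, dist (y i) (x i) ^ 2) ≤ √((n * a) ^ 2) := by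
        apply Real.sqrt_le_sqrt
        calc ∑ i, dist (y i) (x i) ^ 2 ≤ ∑ _i : Fin n, a ^ 2 :=
              Finset.sum_le_sum fun i _ => pow_le_pow_left₀ dist_nonneg (h i) 2
          _ = n * a ^ 2 := by simp
          _ ≤ (n * a) ^ 2 := by
              rw [mul_pow]
              gcongr
              exact_mod_cast Nat.le_self_pow two_ne_zero n
    _ = n * a := Real.sqrt_sq (by positivity)

lemma dist_le_of_mem_dyadicCell (h : y ∈ dyadicCell k x) : dist y x ≤ n * ((2 : ℝ) ^ k)⁻¹ := by
  refine EuclideanSpace.dist_le_mul_of_forall fun i => ?_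
  have h2 : (0 : ℝ) < 2 ^ k := by positivity
  have := Int.abs_sub_lt_one_of_floor_eq_floor (h i)
  rw [← mul_sub, abs_mul, abs_of_pos h2] at this
  rw [← one_div, le_div_iff₀ h2]
  linarith

lemma dyadicCell_subset_closedBall :
    dyadicCell k x ⊆ closedBall x (n * ((2 : ℝ) ^ k)⁻¹) :=
  fun _ hy => dist_le_of_mem_dyadicCell hy

end DyadicCell

section Poincare

variable {n : ℕ} {k : ℕ} {x : EuclideanSpace ℝ (Fin n)}
  {W : Type*} [NormedAddCommGroup W] [NormedSpace ℝ W]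

/-- The average of `F` over a dyadic cube. -/
def cellAvg (k : ℕ) (x : EuclideanSpace ℝ (Fin n)) (F : EuclideanSpace ℝ (Fin n) → W) : W :=
  ((2 : ℝ) ^ k) ^ n • ∫ y in dyadicCell k x, F y

/-- Each dyadic cube is mapped onto a given child by a homothety whose center is a corner. -/
lemma exists_homothety_dyadicCell (k : ℕ) (x : EuclideanSpace ℝ (Fin n)) :
    ∃ e : EuclideanSpace ℝ (Fin n),
      (∀ c ∈ Icc (1 / 2 : ℝ) 1, ∀ y ∈ dyadicCell k x, e + c • (y - e) ∈ dyadicCell k x) ∧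
      (∀ y ∈ dyadicCell k x, ‖y - e‖ ≤ n * ((2 : ℝ) ^ k)⁻¹) ∧
      (fun y => e + (1 / 2 : ℝ) • (y - e)) '' dyadicCell k x = dyadicCell (k + 1) x := by
  have h2 : (0 : ℝ) < 2 ^ k := by positivity
  obtain ⟨e, he⟩ : ∃ e : EuclideanSpace ℝ (Fin n), ∀ i, (2 : ℝ) ^ k * e i =
      ⌊(2 : ℝ) ^ (k + 1) * x i⌋ - ⌊(2 : ℝ) ^ k * x i⌋ :=
    ⟨WithLp.toLp 2 fun i => (⌊(2 : ℝ) ^ (k + 1) * x i⌋ - ⌊(2 : ℝ) ^ k * x i⌋) / 2 ^ k,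
      fun i => by simp; field_simp⟩
  have hz : ∀ i, ⌊(2 : ℝ) ^ (k + 1) * x i⌋ = 2 * ⌊(2 : ℝ) ^ k * x i⌋ ∨
      ⌊(2 : ℝ) ^ (k + 1) * x i⌋ = 2 * ⌊(2 : ℝ) ^ k * x i⌋ + 1 := by
    intro i
    have h3 := Int.floor_le ((2 : ℝ) ^ k * x i)
    have h4 := Int.lt_floor_add_one ((2 : ℝ) ^ k * x i)
    have h5 : 2 * ⌊(2 : ℝ) ^ k * x i⌋ ≤ ⌊(2 : ℝ) ^ (k + 1) * x i⌋ := by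
      apply Int.le_floor.2; push_cast; rw [pow_succ]; linarith
    have h6 : ⌊(2 : ℝ) ^ (k + 1) * x i⌋ < 2 * ⌊(2 : ℝ) ^ k * x i⌋ + 2 := by
      apply Int.floor_lt.2; push_cast; rw [pow_succ]; linarith
    omega
  have hz' : ∀ i, (2 : ℝ) ^ k * e i = ⌊(2 : ℝ) ^ k * x i⌋ ∨
      (2 : ℝ) ^ k * e i = ⌊(2 : ℝ) ^ k * x i⌋ + 1 := by
    intro i
    rw [he]
    rcases hz i with h | h <;> rw [h] <;> push_cast
    · left; ring
    · right; ring
  refine ⟨e, ?_, ?_, ?_⟩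
  · intro c hc y hy i
    have h3 := Int.floor_le ((2 : ℝ) ^ k * y i)
    have h4 := Int.lt_floor_add_one ((2 : ℝ) ^ k * y i)
    rw [hy i] at h3 h4
    have hcoord : (2 : ℝ) ^ k * (e + c • (y - e)) i =
        (1 - c) * (2 ^ k * e i) + c * (2 ^ k * y i) := by
      simp; ring
    rw [Int.floor_eq_iff, hcoord]
    have hc0 : 0 < c := by linarith [hc.1]
    have hc1 : 0 ≤ 1 - c := by linarith [hc.2]
    rcases hz' i with h | h <;> rw [h] <;> constructor <;> nlinarith
  · intro y hy
    rw [← dist_eq_norm]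
    refine EuclideanSpace.dist_le_mul_of_forall fun i => ?_
    have h3 := Int.floor_le ((2 : ℝ) ^ k * y i)
    have h4 := Int.lt_floor_add_one ((2 : ℝ) ^ k * y i)
    rw [hy i] at h3 h4
    have h5 : |y i - e i| * 2 ^ k = |2 ^ k * y i - 2 ^ k * e i| := by
      rw [← mul_sub, abs_mul, abs_of_pos h2, mul_comm]
    rw [← one_div, le_div_iff₀ h2, h5, abs_le]
    rcases hz' i with h | h <;> constructor <;> nlinarith
  · ext y
    constructor
    · rintro ⟨w, hw, rfl⟩ i
      have h3 := Int.floor_le ((2 : ℝ) ^ k * w i)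
      have h4 := Int.lt_floor_add_one ((2 : ℝ) ^ k * w i)
      rw [hw i] at h3 h4
      have hcoord : (2 : ℝ) ^ (k + 1) * (e + (1 / 2 : ℝ) • (w - e)) i =
          2 ^ k * e i + 2 ^ k * w i := by
        simp; ring
      rw [Int.floor_eq_iff, hcoord, he]
      constructor <;> linarith
    · intro hy
      refine ⟨(2 : ℝ) • y - e, fun i => ?_, ?_⟩
      · have h3 := Int.floor_le ((2 : ℝ) ^ (k + 1) * y i)
        have h4 := Int.lt_floor_add_one ((2 : ℝ) ^ (k + 1) * y i)
        rw [hy i] at h3 h4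
        have hcoord : (2 : ℝ) ^ k * ((2 : ℝ) • y - e) i = 2 ^ (k + 1) * y i - 2 ^ k * e i := by
          simp; ring
        rw [Int.floor_eq_iff, hcoord, he]
        constructor <;> linarith
      · ext i
        simp
        ring

/-- The Jacobian of a homothety. -/
lemma det_smul_id (c : ℝ) :
    (c • ContinuousLinearMap.id ℝ (EuclideanSpace ℝ (Fin n))).det = c ^ n := by
  rw [ContinuousLinearMap.det]
  simp [LinearMap.det_smul]

lemma hasFDerivAt_homothety (e : EuclideanSpace ℝ (Fin n)) (c : ℝ)
    (y : EuclideanSpace ℝ (Fin n)) :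
    HasFDerivAt (fun y => e + c • (y - e))
      (c • ContinuousLinearMap.id ℝ (EuclideanSpace ℝ (Fin n))) y :=
  (((hasFDerivAt_id y).sub_const e).const_smul c).const_add e

lemma injective_homothety (e : EuclideanSpace ℝ (Fin n)) {c : ℝ} (hc : c ≠ 0) :
    Function.Injective (fun y => e + c • (y - e)) := by
  intro a b hab
  have := smul_right_injective _ hc (add_left_cancel hab)
  exact sub_left_injective this

lemma lintegral_comp_homothety_le {e : EuclideanSpace ℝ (Fin n)}
    {Q : Set (EuclideanSpace ℝ (Fin n))} (hQ : MeasurableSet Q) {c : ℝ} (hc : 1 / 2 ≤ c)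
    (hcQ : ∀ y ∈ Q, e + c • (y - e) ∈ Q) (φ : EuclideanSpace ℝ (Fin n) → ℝ≥0∞) :
    ∫⁻ y in Q, φ (e + c • (y - e)) ≤ 2 ^ n * ∫⁻ y in Q, φ y := by
  have hc0 : 0 < c := by linarith
  have key := lintegral_image_eq_lintegral_abs_det_fderiv_mul volume hQ
    (fun y _ => (hasFDerivAt_homothety e c y).hasFDerivWithinAt)
    ((injective_homothety e hc0.ne').injOn) φ
  simp only [det_smul_id] at key
  have hle : ∫⁻ y in Q, ENNReal.ofReal |c ^ n| * φ (e + c • (y - e)) ≤ ∫⁻ y in Q, φ y := by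
    rw [← key]
    exact lintegral_mono_set (image_subset_iff.2 hcQ)
  rw [lintegral_const_mul' _ _ ENNReal.ofReal_ne_top] at hle
  have h1 : 1 ≤ (2 : ℝ≥0∞) ^ n * ENNReal.ofReal |c ^ n| := by
    rw [abs_of_pos (by positivity), ENNReal.ofReal_pow hc0.le, ← mul_pow]
    apply one_le_pow₀
    have h2 : ENNReal.ofReal (2 * c) = 2 * ENNReal.ofReal c := by
      rw [ENNReal.ofReal_mul (by norm_num)]; simp
    rw [← h2, ENNReal.one_le_ofReal]
    linarith
  calc ∫⁻ y in Q, φ (e + c • (y - e))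
      ≤ 2 ^ n * ENNReal.ofReal |c ^ n| * ∫⁻ y in Q, φ (e + c • (y - e)) :=
        le_mul_of_one_le_left zero_le h1
    _ ≤ _ := by rw [mul_assoc]; gcongr

lemma enorm_sub_homothety_le [CompleteSpace W] {F : EuclideanSpace ℝ (Fin n) → W}
    (hF : ContDiff ℝ 1 F) (e y : EuclideanSpace ℝ (Fin n)) :
    ‖F y - F (e + (1 / 2 : ℝ) • (y - e))‖ₑ ≤
      ∫⁻ c in Icc (1 / 2 : ℝ) 1, ‖fderiv ℝ F (e + c • (y - e))‖ₑ * ‖y - e‖ₑ := by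
  have hγ : ContDiff ℝ 1 fun c : ℝ => e + c • (y - e) := by fun_prop
  have h := enorm_sub_le_lintegral_deriv_of_contDiffOn_Icc (f := fun c => F (e + c • (y - e)))
    (a := 1 / 2) (b := 1) (hF.comp hγ).contDiffOn (by norm_num)
  simp only [one_smul, add_sub_cancel] at h
  refine h.trans (lintegral_mono fun c => ?_)
  have hd : HasDerivAt (fun c : ℝ => e + c • (y - e)) (y - e) c := by
    simpa using ((hasDerivAt_id c).smul_const (y - e)).const_add e
  have := ((hF.differentiable one_ne_zero (e + c • (y - e))).hasFDerivAt.comp_hasDerivAt c hd).deriv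
  simp only [Function.comp_def] at this
  rw [this]
  exact ContinuousLinearMap.le_opENorm _ _

/-- A Poincaré inequality: the averages of a smooth function over a dyadic cube and one of its
children differ by at most a multiple of the side length times the average of the gradient. -/
lemma enorm_cellAvg_succ_sub_le [CompleteSpace W] {F : EuclideanSpace ℝ (Fin n) → W}
    (hF : ContDiff ℝ 1 F) (k : ℕ) (x : EuclideanSpace ℝ (Fin n)) :
    ‖cellAvg (k + 1) x F - cellAvg k x F‖ₑ ≤
      ENNReal.ofReal (2 ^ n * n * ((2 : ℝ) ^ k)⁻¹ * ((2 : ℝ) ^ k) ^ n) *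
        ∫⁻ y in dyadicCell k x, ‖fderiv ℝ F y‖ₑ := by
  obtain ⟨e, he1, he2, he3⟩ := exists_homothety_dyadicCell k x
  set Q := dyadicCell k x
  have hQ : MeasurableSet Q := measurableSet_dyadicCell
  have hint : ∀ G : EuclideanSpace ℝ (Fin n) → W, Continuous G → IntegrableOn G Q := fun G hG =>
    (hG.continuousOn.integrableOn_compact (isCompact_closedBall x _)).mono_set
      dyadicCell_subset_closedBall
  have hFc := hF.continuous
  have hchild : cellAvg (k + 1) x F =
      ((2 : ℝ) ^ k) ^ n • ∫ y in Q, F (e + (1 / 2 : ℝ) • (y - e)) := by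
    rw [cellAvg, ← he3, integral_image_eq_integral_abs_det_fderiv_smul volume hQ
      (fun y _ => (hasFDerivAt_homothety e (1 / 2) y).hasFDerivWithinAt)
      ((injective_homothety e (by norm_num)).injOn)]
    simp only [det_smul_id]
    rw [integral_smul, smul_smul]
    congr 1
    rw [abs_of_pos (by positivity), pow_succ, mul_pow, mul_assoc, ← mul_pow]
    norm_num
  have hdiff : cellAvg (k + 1) x F - cellAvg k x F =
      ((2 : ℝ) ^ k) ^ n • ∫ y in Q, (F (e + (1 / 2 : ℝ) • (y - e)) - F y) := by
    rw [hchild, cellAvg, ← smul_sub, integral_sub (hint _ (by fun_prop)) (hint _ hFc)]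
  have hD : Continuous fun p : EuclideanSpace ℝ (Fin n) × ℝ =>
      ‖fderiv ℝ F (e + p.2 • (p.1 - e))‖ₑ :=
    ((hF.continuous_fderiv one_ne_zero).comp (by fun_prop)).enorm
  calc ‖cellAvg (k + 1) x F - cellAvg k x F‖ₑ
      = ENNReal.ofReal (((2 : ℝ) ^ k) ^ n) *
          ‖∫ y in Q, (F (e + (1 / 2 : ℝ) • (y - e)) - F y)‖ₑ := by
        rw [hdiff, enorm_smul, Real.enorm_of_nonneg (by positivity)]
    _ ≤ ENNReal.ofReal (((2 : ℝ) ^ k) ^ n) *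
          (ENNReal.ofReal (n * ((2 : ℝ) ^ k)⁻¹) * (2 ^ n * ∫⁻ y in Q, ‖fderiv ℝ F y‖ₑ)) := by
        gcongr
        calc ‖∫ y in Q, (F (e + (1 / 2 : ℝ) • (y - e)) - F y)‖ₑ
            ≤ ∫⁻ y in Q, ‖F (e + (1 / 2 : ℝ) • (y - e)) - F y‖ₑ := enorm_integral_le_lintegral_enorm _
          _ ≤ ∫⁻ y in Q, ∫⁻ c in Icc (1 / 2 : ℝ) 1, ENNReal.ofReal (n * ((2 : ℝ) ^ k)⁻¹) *
                ‖fderiv ℝ F (e + c • (y - e))‖ₑ := by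
              refine setLIntegral_mono' hQ fun y hy => ?_
              rw [← enorm_neg, neg_sub]
              refine (enorm_sub_homothety_le hF e y).trans (lintegral_mono fun c => ?_)
              rw [mul_comm]
              gcongr
              rw [← ofReal_norm]
              exact ENNReal.ofReal_le_ofReal (he2 y hy)
          _ = ∫⁻ c in Icc (1 / 2 : ℝ) 1, ∫⁻ y in Q, ENNReal.ofReal (n * ((2 : ℝ) ^ k)⁻¹) *
                ‖fderiv ℝ F (e + c • (y - e))‖ₑ :=
              lintegral_lintegral_swap (hD.measurable.const_mul _).aemeasurable
          _ ≤ ∫⁻ c in Icc (1 / 2 : ℝ) 1, ENNReal.ofReal (n * ((2 : ℝ) ^ k)⁻¹) *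
                (2 ^ n * ∫⁻ y in Q, ‖fderiv ℝ F y‖ₑ) := by
              refine setLIntegral_mono' measurableSet_Icc fun c hc => ?_
              rw [lintegral_const_mul' _ _ ENNReal.ofReal_ne_top]
              gcongr
              exact lintegral_comp_homothety_le hQ hc.1 (he1 c hc) fun y => ‖fderiv ℝ F y‖ₑ
          _ ≤ _ := by
              rw [setLIntegral_const]
              refine mul_le_of_le_one_right zero_le ?_
              rw [Real.volume_Icc]
              norm_num
    _ = _ := by
        rw [← mul_assoc, ← mul_assoc]
        congr 1
        have h2 : (2 : ℝ≥0∞) ^ n = ENNReal.ofReal (2 ^ n) := by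
          rw [ENNReal.ofReal_pow (by norm_num)]; simp
        rw [h2, ← ENNReal.ofReal_mul (by positivity), ← ENNReal.ofReal_mul (by positivity)]
        congr 1
        ring

end Poincare

/-- `Df` is a locally integrable weak derivative of `f` on `V`. -/
def HasWeakDerivOn {n : ℕ} {W : Type*} [NormedAddCommGroup W] [NormedSpace ℝ W]
    (f : EuclideanSpace ℝ (Fin n) → W) (Df : EuclideanSpace ℝ (Fin n) → (EuclideanSpace ℝ (Fin n) →L[ℝ] W))
    (V : Set (EuclideanSpace ℝ (Fin n))) : Prop :=
  LocallyIntegrableOn Df V volume ∧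
    ∀ φ : EuclideanSpace ℝ (Fin n) → ℝ, ContDiff ℝ (⊤ : ℕ∞) φ → HasCompactSupport φ →
      tsupport φ ⊆ V → ∀ v : EuclideanSpace ℝ (Fin n),
        (∫ x in V, (fderiv ℝ φ x v) • f x) = - ∫ x in V, (φ x) • (Df x v)

section WeakDerivative

variable {n : ℕ} {W : Type*} [NormedAddCommGroup W] [NormedSpace ℝ W]
  {V B Q : Set (EuclideanSpace ℝ (Fin n))} {f : EuclideanSpace ℝ (Fin n) → W}
  {Df : EuclideanSpace ℝ (Fin n) → (EuclideanSpace ℝ (Fin n) →L[ℝ] W)}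

/-- The operator norm of the gradient of a mollification is bounded by the mollification of the
norm of the weak gradient. -/
lemma HasWeakDerivOn.enorm_fderiv_convolution_le (h : HasWeakDerivOn f Df V)
    (hf : ContinuousOn f V) (hB : IsCompact B) (hBV : B ⊆ V) (hVo : IsOpen V)
    (φ : ContDiffBump (0 : EuclideanSpace ℝ (Fin n))) {y : EuclideanSpace ℝ (Fin n)}
    (hy : closedBall y φ.rOut ⊆ B) :
    ‖fderiv ℝ (convolution (B.indicator f) (φ.normed volume)
      (ContinuousLinearMap.lsmul ℝ ℝ).flip volume) y‖ₑ ≤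
      ∫⁻ t in V, ‖φ.normed volume (y - t)‖ₑ * ‖Df t‖ₑ := by
  set χ := φ.normed (volume : Measure (EuclideanSpace ℝ (Fin n))) with hχ
  have hχd : ContDiff ℝ (⊤ : ℕ∞) χ := φ.contDiff_normed
  have hχc : HasCompactSupport χ := φ.hasCompactSupport_normed
  have hfi : LocallyIntegrable (B.indicator f) volume :=
    (((hf.mono hBV).integrableOn_compact hB).integrable_indicator hB.measurableSet).locallyIntegrable
  have hd := hχc.hasFDerivAt_convolution_right (ContinuousLinearMap.lsmul ℝ ℝ : ℝ →L[ℝ] W →L[ℝ] W).flip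
    hfi (hχd.of_le (by exact_mod_cast le_top)) y
  rw [hd.fderiv]
  set T := ∫⁻ t in V, ‖χ (y - t)‖ₑ * ‖Df t‖ₑ with hT
  by_cases hTtop : T = ⊤
  · rw [hTtop]; exact le_top
  have hψsupp : tsupport (fun t => χ (y - t)) ⊆ closedBall y φ.rOut := by
    refine closure_minimal (fun t ht => ?_) isClosed_closedBall
    have : y - t ∈ Function.support χ := ht
    rw [φ.support_normed_eq] at this
    rw [mem_closedBall, dist_comm, dist_eq_norm]
    exact (mem_ball_zero_iff.1 this).le
  rw [← ofReal_norm, ← ENNReal.ofReal_toReal hTtop]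
  refine ENNReal.ofReal_le_ofReal (ContinuousLinearMap.opNorm_le_bound _ ENNReal.toReal_nonneg fun v => ?_)
  rw [convolution_precompR_apply _ hfi (hχc.fderiv ℝ) (hχd.continuous_fderiv (by simp))]
  have hψd : ContDiff ℝ (⊤ : ℕ∞) fun t => χ (y - t) := hχd.comp (by fun_prop)
  have hψf : ∀ t, fderiv ℝ (fun t => χ (y - t)) t v = - fderiv ℝ χ (y - t) v := by
    intro t
    have h1 : HasFDerivAt (fun t => y - t) (-ContinuousLinearMap.id ℝ (EuclideanSpace ℝ (Fin n))) t :=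
      (hasFDerivAt_id t).const_sub y
    have h2 := ((hχd.differentiable (by simp)) (y - t)).hasFDerivAt.comp t h1
    rw [show (fun t => χ (y - t)) = χ ∘ fun t => y - t from rfl, h2.fderiv]
    simp
  have hw := h.2 (fun t => χ (y - t)) hψd
    (HasCompactSupport.of_support_subset_isCompact (isCompact_closedBall y φ.rOut)
      (subset_tsupport _ |>.trans hψsupp)) (hψsupp.trans (hy.trans hBV)) v
  have heq : convolution (B.indicator f) (fun a => fderiv ℝ χ a v)
      (ContinuousLinearMap.lsmul ℝ ℝ).flip volume y = ∫ t in V, χ (y - t) • Df t v := by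
    rw [← neg_eq_iff_eq_neg.2 hw, convolution_def, ← integral_neg, ← integral_indicator hVo.measurableSet]
    refine integral_congr_ae (ae_of_all _ fun t => ?_)
    simp only [hψf, ContinuousLinearMap.flip_apply, ContinuousLinearMap.lsmul_apply, neg_smul, neg_neg]
    by_cases htB : t ∈ B
    · simp [htB, hBV htB]
    · have h0 : fderiv ℝ (fun t => χ (y - t)) t = 0 := by
        apply image_eq_zero_of_notMem_tsupport
        exact fun h' => htB (hy (hψsupp (tsupport_fderiv_subset ℝ h')))
      have h0' : fderiv ℝ χ (y - t) v = 0 := by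
        rw [← neg_eq_zero, ← hψf, h0]; simp
      simp [htB, h0', indicator]
  rw [heq]
  have h3 : ‖∫ t in V, χ (y - t) • Df t v‖ₑ ≤ T * ‖v‖ₑ := by
    refine (enorm_integral_le_lintegral_enorm _).trans ?_
    rw [hT, ← lintegral_mul_const' _ _ enorm_ne_top]
    refine lintegral_mono fun t => ?_
    rw [enorm_smul, mul_assoc]
    gcongr
    exact ContinuousLinearMap.le_opENorm _ _
  have h4 := ENNReal.toReal_mono (by finiteness) h3
  rwa [ENNReal.toReal_mul, toReal_enorm, toReal_enorm] at h4

lemma lintegral_convolution_bump_le {ν : Measure (EuclideanSpace ℝ (Fin n))} [SFinite ν]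
    (φ : ContDiffBump (0 : EuclideanSpace ℝ (Fin n))) {g : EuclideanSpace ℝ (Fin n) → ℝ≥0∞}
    (hg : AEMeasurable g ν) (hQ : MeasurableSet Q) :
    ∫⁻ y in Q, ∫⁻ t, ‖φ.normed volume (y - t)‖ₑ * g t ∂ν ≤ ∫⁻ t in cthickening φ.rOut Q, g t ∂ν := by
  set χ := φ.normed (volume : Measure (EuclideanSpace ℝ (Fin n))) with hχ
  have hχc : Continuous χ := φ.continuous_normed
  rw [lintegral_lintegral_swap]
  · rw [← lintegral_indicator isClosed_cthickening.measurableSet]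
    refine lintegral_mono fun t => ?_
    by_cases ht : t ∈ cthickening φ.rOut Q
    · rw [indicator_of_mem ht]
      have hm : Measurable fun y => ‖χ (y - t)‖ₑ :=
        (hχc.comp (continuous_id.sub continuous_const)).enorm.measurable
      rw [lintegral_mul_const _ hm]
      refine mul_le_of_le_one_left zero_le ?_
      calc ∫⁻ y in Q, ‖χ (y - t)‖ₑ ≤ ∫⁻ y, ‖χ (y - t)‖ₑ := setLIntegral_le_lintegral _ _
        _ = ∫⁻ y, ‖χ y‖ₑ := lintegral_sub_right_eq_self (fun y => ‖χ y‖ₑ) t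
        _ = ENNReal.ofReal (∫ y, χ y) := by
          rw [ofReal_integral_eq_lintegral_ofReal φ.integrable_normed (ae_of_all _ φ.nonneg_normed)]
          exact lintegral_congr fun y => Real.enorm_of_nonneg (φ.nonneg_normed y)
        _ = 1 := by rw [φ.integral_normed]; simp
        _ ≤ 1 := le_rfl
    · rw [indicator_of_notMem ht, nonpos_iff_eq_zero]
      have : ∀ y ∈ Q, χ (y - t) = 0 := by
        intro y hy
        by_contra hne
        have h1 : y - t ∈ Function.support χ := hne
        rw [φ.support_normed_eq] at h1
        refine ht (mem_cthickening_of_dist_le t y _ Q hy ?_)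
        rw [dist_comm, dist_eq_norm]
        exact (mem_ball_zero_iff.1 h1).le
      rw [setLIntegral_congr_fun hQ fun y hy => by rw [this y hy, enorm_zero, zero_mul]]
      simp
  · refine AEMeasurable.mul ?_ hg.comp_snd
    exact (hχc.comp (continuous_fst.sub continuous_snd)).enorm.measurable.aemeasurable

/-- The Poincaré inequality for averages over a dyadic cube and its children, for continuous
functions with a weak gradient. -/
lemma HasWeakDerivOn.enorm_cellAvg_succ_sub_le [CompleteSpace W] (h : HasWeakDerivOn f Df V)
    (hf : ContinuousOn f V) (hVo : IsOpen V) {k : ℕ} {x : EuclideanSpace ℝ (Fin n)}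
    (hV : closedBall x (n * ((2 : ℝ) ^ k)⁻¹) ⊆ V) :
    ‖cellAvg (k + 1) x f - cellAvg k x f‖ₑ ≤
      ENNReal.ofReal (2 ^ n * n * ((2 : ℝ) ^ k)⁻¹ * ((2 : ℝ) ^ k) ^ n) *
        ∫⁻ y in dyadicCell k x, ‖Df y‖ₑ := by
  set B := closedBall x (n * ((2 : ℝ) ^ k)⁻¹) with hB
  set Q := dyadicCell k x with hQ
  have hQm : MeasurableSet Q := measurableSet_dyadicCell
  have hQB : Q ⊆ B := dyadicCell_subset_closedBall
  have hBc : IsCompact B := isCompact_closedBall _ _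
  obtain ⟨δ₀, hδ₀, hδV⟩ := hBc.exists_cthickening_subset_open hVo hV
  set K := cthickening δ₀ B with hK
  have hKc : IsCompact K := hBc.cthickening
  have hfK : UniformContinuousOn f K := hKc.uniformContinuousOn_of_continuous (hf.mono hδV)
  have hDfm : AEStronglyMeasurable Df (volume.restrict V) := h.1.aestronglyMeasurable
  let φ : ℕ → ContDiffBump (0 : EuclideanSpace ℝ (Fin n)) := fun m =>
    ⟨δ₀ / (m + 2) / 2, δ₀ / (m + 2), by positivity, half_lt_self (by positivity)⟩
  have hφ0 : Tendsto (fun m => (φ m).rOut) atTop (𝓝 0) := by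
    have := (tendsto_const_div_atTop_nhds_zero_nat δ₀).comp (tendsto_add_atTop_nat 2)
    refine this.congr fun m => ?_
    simp [φ]
  have hφδ : ∀ m, (φ m).rOut ≤ δ₀ := fun m => div_le_self hδ₀.le (by linarith [m.cast_nonneg (α := ℝ)])
  let F : ℕ → EuclideanSpace ℝ (Fin n) → W := fun m =>
    convolution (K.indicator f) ((φ m).normed volume) (ContinuousLinearMap.lsmul ℝ ℝ).flip volume
  have hfi : IntegrableOn f K := (hf.mono hδV).integrableOn_compact hKc
  have hFd : ∀ m, ContDiff ℝ 1 (F m) := fun m =>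
    (φ m).hasCompactSupport_normed.contDiff_convolution_right _
      (hfi.integrable_indicator hKc.measurableSet).locallyIntegrable ((φ m).contDiff_normed (n := 1))
  have hball : ∀ m, ∀ y ∈ B, closedBall y (φ m).rOut ⊆ K := fun m y hy =>
    (closedBall_subset_cthickening hy _).trans (cthickening_mono (hφδ m) _)
  -- convergence of the averages
  have hlim : ∀ j, dyadicCell j x ⊆ Q →
      Tendsto (fun m => cellAvg j x (F m)) atTop (𝓝 (cellAvg j x f)) := by
    intro j hj
    refine Tendsto.const_smul ?_ _
    have hunif : ∀ ε > 0, ∀ᶠ m in atTop, ∀ y ∈ Q, dist (F m y) (f y) ≤ ε := by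
      intro ε hε
      obtain ⟨δ, hδ, hδf⟩ := Metric.uniformContinuousOn_iff.1 hfK ε hε
      filter_upwards [hφ0.eventually_lt_const hδ] with m hm y hy
      have hyK : y ∈ K := self_subset_cthickening _ (hQB hy)
      have := (φ m).dist_normed_convolution_le (μ := volume) (g := K.indicator f) (x₀ := y) (ε := ε)
        (hfi.integrable_indicator hKc.measurableSet).aestronglyMeasurable (fun z hz => by
          have hzK : z ∈ K := hball m y (hQB hy) (ball_subset_closedBall hz)
          rw [indicator_of_mem hzK, indicator_of_mem hyK]
          exact (hδf z hzK y hyK (lt_trans hz hm)).le)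
      rw [indicator_of_mem hyK, ← convolution_flip] at this
      exact this
    have hfin : volume (dyadicCell j x) ≠ ⊤ := by rw [volume_dyadicCell]; exact ENNReal.ofReal_ne_top
    rw [Metric.tendsto_nhds]
    intro ε hε
    have hε' : 0 < ε / (volume.real (dyadicCell j x) + 1) := by positivity
    filter_upwards [hunif _ hε'] with m hm
    have hFi : IntegrableOn (F m) (dyadicCell j x) :=
      ((hFd m).continuous.continuousOn.integrableOn_compact hBc).mono_set (hj.trans hQB)
    have hfi' : IntegrableOn f (dyadicCell j x) :=
      hfi.mono_set ((hj.trans hQB).trans (self_subset_cthickening _))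
    rw [dist_eq_norm, ← integral_sub hFi hfi']
    refine (norm_setIntegral_le_of_norm_le_const hfin.lt_top
      fun y hy => by rw [← dist_eq_norm]; exact hm y (hj hy)).trans_lt ?_
    rw [div_mul_eq_mul_div, div_lt_iff₀ (by positivity)]
    nlinarith
  have hgrad : ∀ m, ∫⁻ y in Q, ‖fderiv ℝ (F m) y‖ₑ ≤
      ∫⁻ t in cthickening (φ m).rOut Q, ‖Df t‖ₑ ∂(volume.restrict V) := fun m =>
    (setLIntegral_mono' hQm fun y hy => h.enorm_fderiv_convolution_le hf hKc hδV hVo (φ m)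
      (hball m y (hQB hy))).trans (lintegral_convolution_bump_le (φ m) hDfm.enorm hQm)
  set ν := (volume.restrict V).withDensity fun t => ‖Df t‖ₑ with hν
  have hνa : ∀ r, ∫⁻ t in cthickening r Q, ‖Df t‖ₑ ∂(volume.restrict V) = ν (cthickening r Q) :=
    fun r => (withDensity_apply _ isClosed_cthickening.measurableSet).symm
  have hνlim : Tendsto (fun m => ν (cthickening (φ m).rOut Q)) atTop (𝓝 (ν (closure Q))) := by
    refine (tendsto_measure_cthickening ⟨δ₀, hδ₀, ?_⟩).comp hφ0
    refine ((measure_mono (cthickening_subset_of_subset _ hQB)).trans_lt ?_).ne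
    rw [hν, withDensity_apply _ isClosed_cthickening.measurableSet,
      Measure.restrict_restrict isClosed_cthickening.measurableSet]
    exact (lintegral_mono_set inter_subset_left).trans_lt
      (h.1.integrableOn_compact_subset hδV hKc).2
  have hνQ : ν (closure Q) = ∫⁻ y in Q, ‖Df y‖ₑ := by
    rw [hν, withDensity_apply _ isClosed_closure.measurableSet,
      Measure.restrict_restrict isClosed_closure.measurableSet,
      inter_eq_left.2 ((closure_minimal hQB isClosed_closedBall).trans hV)]
    refine setLIntegral_congr ?_
    exact closure_ae_eq_of_null_frontier (convex_dyadicCell.addHaar_frontier volume)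
  have hlim1 := ((hlim (k + 1) dyadicCell_succ_subset).sub (hlim k subset_rfl)).enorm
  refine le_of_tendsto_of_tendsto hlim1
    (ENNReal.Tendsto.const_mul (hνQ ▸ hνlim) (Or.inr ENNReal.ofReal_ne_top)) (Eventually.of_forall fun m => ?_)
  refine (_root_.enorm_cellAvg_succ_sub_le (hFd m) k x).trans ?_
  simp only [← hνa]
  exact mul_le_mul' le_rfl (hgrad m)

end WeakDerivative

section GoodIndices

variable {c : ℕ → ℝ} {lam ρ : ℝ} {k₀ : ℕ}

/-- The index `k` is good for `c` if `c k` dominates all geometrically damped earlier values. -/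
def IsGoodIndex (lam : ℝ) (k₀ : ℕ) (c : ℕ → ℝ) (k : ℕ) : Prop :=
  ∀ j, k₀ ≤ j → j ≤ k → lam ^ (k - j) * c j ≤ c k

lemma isGoodIndex_congr {c' : ℕ → ℝ} {k : ℕ} (h : ∀ j ≤ k, c j = c' j) :
    IsGoodIndex lam k₀ c k ↔ IsGoodIndex lam k₀ c' k := by
  unfold IsGoodIndex
  refine forall_congr' fun j => forall_congr' fun _ => forall_congr' fun hj => ?_
  rw [h j hj, h k le_rfl]

lemma exists_isGoodIndex (h0 : 0 < lam) {k : ℕ} (hk : k₀ ≤ k) :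
    ∃ j, k₀ ≤ j ∧ j ≤ k ∧ IsGoodIndex lam k₀ c j ∧ c k ≤ lam ^ (k - j) * c j := by
  obtain ⟨j, hj, hmax⟩ := (Finset.Icc k₀ k).exists_max_image (fun j => lam ^ (k - j) * c j)
    ⟨k, Finset.mem_Icc.2 ⟨hk, le_rfl⟩⟩
  obtain ⟨hj1, hj2⟩ := Finset.mem_Icc.1 hj
  refine ⟨j, hj1, hj2, fun i hi1 hi2 => ?_, ?_⟩
  · have := hmax i (Finset.mem_Icc.2 ⟨hi1, hi2.trans hj2⟩)
    rw [show k - i = (k - j) + (j - i) by omega, pow_add, mul_assoc] at this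
    exact le_of_mul_le_mul_left this (by positivity)
  · simpa using hmax k (Finset.mem_Icc.2 ⟨hk, le_rfl⟩)

lemma sum_range_pow_le (h0 : 0 ≤ lam) (h1 : lam < 1) (S : Finset ℕ) :
    ∑ i ∈ S, lam ^ i ≤ (1 - lam)⁻¹ := by
  rw [← tsum_geometric_of_lt_one h0 h1]
  exact (summable_geometric_of_lt_one h0 h1).sum_le_tsum S fun i _ => by positivity

open Classical in
lemma sum_le_sum_isGoodIndex (h0 : 0 < lam) (h1 : lam < 1) (hc : ∀ k, 0 ≤ c k) (N : ℕ) :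
    ∑ k ∈ Finset.Ico k₀ N, c k ≤
      (1 - lam)⁻¹ * ∑ k ∈ (Finset.Ico k₀ N).filter (IsGoodIndex lam k₀ c), c k := by
  set S := (Finset.Ico k₀ N).filter (IsGoodIndex lam k₀ c)
  calc ∑ k ∈ Finset.Ico k₀ N, c k
      ≤ ∑ k ∈ Finset.Ico k₀ N, ∑ j ∈ S, if j ≤ k then lam ^ (k - j) * c j else 0 := by
        refine Finset.sum_le_sum fun k hk => ?_
        obtain ⟨hk1, hk2⟩ := Finset.mem_Ico.1 hk
        obtain ⟨j, hj1, hj2, hj3, hj4⟩ := exists_isGoodIndex (c := c) h0 hk1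
        have hjS : j ∈ S := Finset.mem_filter.2 ⟨Finset.mem_Ico.2 ⟨hj1, hj2.trans_lt hk2⟩, hj3⟩
        refine hj4.trans ?_
        have := Finset.single_le_sum (f := fun j => if j ≤ k then lam ^ (k - j) * c j else 0)
          (fun i _ => by
            have := hc i
            split_ifs <;> positivity) hjS
        simpa [hj2] using this
    _ = ∑ j ∈ S, c j * ∑ k ∈ (Finset.Ico k₀ N).filter (j ≤ ·), lam ^ (k - j) := by
        rw [Finset.sum_comm]
        refine Finset.sum_congr rfl fun j _ => ?_
        rw [Finset.mul_sum, Finset.sum_filter]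
        exact Finset.sum_congr rfl fun k _ => by split_ifs <;> ring
    _ ≤ ∑ j ∈ S, c j * (1 - lam)⁻¹ := by
        refine Finset.sum_le_sum fun j _ => mul_le_mul_of_nonneg_left ?_ (hc j)
        rw [← Finset.sum_image (f := fun i => lam ^ i) (g := fun k => k - j)]
        · exact sum_range_pow_le h0.le h1 _
        · intro a ha b hb hab
          simp only [Finset.coe_filter, mem_ofPred_eq] at ha hb
          dsimp only at hab
          omega
    _ = _ := by rw [Finset.mul_sum]; exact Finset.sum_congr rfl fun _ _ => mul_comm _ _

lemma sum_le_of_geometric_growth {t : ℕ → ℝ} {S : Finset ℕ} {B : ℝ} (h0 : 0 ≤ ρ) (h1 : ρ < 1)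
    (hB : 0 ≤ B) (ht : ∀ j ∈ S, ∀ k ∈ S, j ≤ k → t j ≤ ρ ^ (k - j) * t k)
    (htB : ∀ k ∈ S, t k ≤ B) : ∑ k ∈ S, t k ≤ (1 - ρ)⁻¹ * B := by
  have h2 : 0 < 1 - ρ := by linarith
  rcases S.eq_empty_or_nonempty with rfl | hS
  · simp; positivity
  set m := S.max' hS
  have hm : m ∈ S := S.max'_mem hS
  calc ∑ k ∈ S, t k ≤ ∑ k ∈ S, ρ ^ (m - k) * B := by
        refine Finset.sum_le_sum fun k hk => (ht k hk m hm (S.le_max' k hk)).trans ?_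
        have := htB m hm
        gcongr
    _ = (∑ i ∈ S.image (m - ·), ρ ^ i) * B := by
        rw [Finset.sum_mul, Finset.sum_image]
        intro a ha b hb hab
        have ha' := S.le_max' a ha
        have hb' := S.le_max' b hb
        dsimp only at hab
        omega
    _ ≤ _ := by gcongr; exact sum_range_pow_le h0 h1 _

end GoodIndices

/-- The lower corner of the dyadic cube containing `x`. -/
def dyadicCorner {n : ℕ} (k : ℕ) (x : EuclideanSpace ℝ (Fin n)) : EuclideanSpace ℝ (Fin n) :=
  WithLp.toLp 2 fun i => (⌊(2 : ℝ) ^ k * x i⌋ : ℝ) / 2 ^ k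

section Corner

variable {n : ℕ} {k j : ℕ} {x y : EuclideanSpace ℝ (Fin n)}

lemma dyadicCorner_mem : dyadicCorner k x ∈ dyadicCell k x := by
  intro i
  have : (2 : ℝ) ^ k * dyadicCorner k x i = ⌊(2 : ℝ) ^ k * x i⌋ := by
    simp only [dyadicCorner]
    field_simp
  rw [this, Int.floor_intCast]

lemma dyadicCell_dyadicCorner : dyadicCell k (dyadicCorner k x) = dyadicCell k x :=
  dyadicCell_eq_of_mem dyadicCorner_mem

lemma dyadicCorner_eq_of_mem (h : y ∈ dyadicCell k x) : dyadicCorner k y = dyadicCorner k x := by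
  ext i
  simp only [dyadicCorner, h i]

lemma dyadicCorner_dyadicCorner : dyadicCorner k (dyadicCorner k x) = dyadicCorner k x :=
  dyadicCorner_eq_of_mem dyadicCorner_mem

/-- A bounded set is covered by finitely many dyadic cubes of a given level. -/
lemma finite_image_dyadicCorner {E : Set (EuclideanSpace ℝ (Fin n))} (hE : Bornology.IsBounded E)
    (k : ℕ) : (dyadicCorner k '' E).Finite := by
  obtain ⟨C, hC⟩ := isBounded_iff_forall_norm_le.1 hE
  have hfin : (univ.pi fun _ : Fin n => Icc (⌊(2 : ℝ) ^ k * (-C)⌋) ⌊(2 : ℝ) ^ k * C⌋).Finite :=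
    Set.Finite.pi fun _ => Set.finite_Icc _ _
  refine (hfin.image fun z => (WithLp.toLp 2 fun i => (z i : ℝ) / 2 ^ k :
    EuclideanSpace ℝ (Fin n))).subset ?_
  rintro _ ⟨x, hx, rfl⟩
  refine ⟨fun i => ⌊(2 : ℝ) ^ k * x i⌋, fun i _ => ?_, rfl⟩
  have hxi := abs_le.1 ((PiLp.norm_apply_le x i).trans (hC x hx))
  exact ⟨Int.floor_le_floor (by gcongr; exact hxi.1), Int.floor_le_floor (by gcongr; exact hxi.2)⟩

end Corner

section CellAverages

variable {n : ℕ} {k j : ℕ} {x y : EuclideanSpace ℝ (Fin n)} {G : EuclideanSpace ℝ (Fin n) → ℝ}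
  {W : Type*} [NormedAddCommGroup W] [NormedSpace ℝ W]

lemma cellAvg_eq_of_mem (F : EuclideanSpace ℝ (Fin n) → W) (h : y ∈ dyadicCell k x) :
    cellAvg k y F = cellAvg k x F := by
  rw [cellAvg, dyadicCell_eq_of_mem h, cellAvg]

lemma cellAvg_const_of_forall [CompleteSpace W] {F : EuclideanSpace ℝ (Fin n) → W} {w : W}
    (h : ∀ y ∈ dyadicCell k x, F y = w) : cellAvg k x F = w := by
  rw [cellAvg, setIntegral_congr_fun measurableSet_dyadicCell h, setIntegral_const,
    volume_real_dyadicCell, smul_smul, ← mul_pow, mul_inv_cancel₀ (by positivity), one_pow, one_smul]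

lemma norm_cellAvg_sub_le [CompleteSpace W] {F : EuclideanSpace ℝ (Fin n) → W} {w : W} {ε : ℝ}
    (hF : IntegrableOn F (dyadicCell k x)) (h : ∀ y ∈ dyadicCell k x, ‖F y - w‖ ≤ ε) :
    ‖cellAvg k x F - w‖ ≤ ε := by
  have hfin : volume (dyadicCell k x) < ⊤ := by rw [volume_dyadicCell]; exact ENNReal.ofReal_lt_top
  have h1 : cellAvg k x F - w = ((2 : ℝ) ^ k) ^ n • ∫ y in dyadicCell k x, (F y - w) := by
    rw [integral_sub hF (integrableOn_const hfin.ne), smul_sub]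
    congr 1
    exact (cellAvg_const_of_forall (F := fun _ => w) fun _ _ => rfl).symm
  rw [h1, norm_smul, Real.norm_of_nonneg (by positivity)]
  calc ((2 : ℝ) ^ k) ^ n * ‖∫ y in dyadicCell k x, (F y - w)‖
      ≤ ((2 : ℝ) ^ k) ^ n * (ε * volume.real (dyadicCell k x)) := by
        gcongr
        exact norm_setIntegral_le_of_norm_le_const hfin h
    _ = ε := by
        rw [volume_real_dyadicCell, mul_left_comm, ← mul_pow, mul_inv_cancel₀ (by positivity)]
        simp

lemma one_le_cellAvg (hG : IntegrableOn G (dyadicCell k x)) (h1 : ∀ y, 1 ≤ G y) :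
    1 ≤ cellAvg k x G := by
  have hfin : volume (dyadicCell k x) < ⊤ := by rw [volume_dyadicCell]; exact ENNReal.ofReal_lt_top
  rw [← cellAvg_const_of_forall (k := k) (x := x) (F := fun _ => (1 : ℝ)) fun _ _ => rfl]
  unfold cellAvg
  refine mul_le_mul_of_nonneg_left ?_ (by positivity)
  exact setIntegral_mono (integrableOn_const hfin.ne) hG h1

lemma cellAvg_le_of_mem (hG : IntegrableOn G (dyadicCell k x)) (h0 : ∀ y, 0 ≤ G y) (hkj : k ≤ j)
    (hy : y ∈ dyadicCell k x) : cellAvg j y G ≤ ((2 : ℝ) ^ (j - k)) ^ n * cellAvg k x G := by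
  simp only [cellAvg, smul_eq_mul]
  rw [← mul_assoc, ← mul_pow, ← pow_add, Nat.sub_add_cancel hkj]
  refine mul_le_mul_of_nonneg_left ?_ (by positivity)
  refine setIntegral_mono_set hG (ae_of_all _ h0) ?_
  rw [← dyadicCell_eq_of_mem hy]
  exact (dyadicCell_anti hkj).eventuallyLE

lemma ofReal_cellAvg (hG : IntegrableOn G (dyadicCell k x)) (h0 : ∀ y, 0 ≤ G y) :
    ENNReal.ofReal (cellAvg k x G) =
      ENNReal.ofReal (((2 : ℝ) ^ k) ^ n) * ∫⁻ y in dyadicCell k x, ENNReal.ofReal (G y) := by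
  rw [cellAvg, smul_eq_mul, ENNReal.ofReal_mul (by positivity),
    ofReal_integral_eq_lintegral_ofReal hG (ae_of_all _ h0)]

/-- Jensen's inequality for averages over dyadic cubes. -/
lemma lintegral_rpow_inv_le_cellAvg {q : ℝ} (hq : 1 ≤ q) (hG : IntegrableOn G (dyadicCell k x))
    (h0 : ∀ y, 0 ≤ G y) :
    ENNReal.ofReal (((2 : ℝ) ^ k) ^ n) * ∫⁻ y in dyadicCell k x, ENNReal.ofReal (G y ^ (1 / q)) ≤
      ENNReal.ofReal (cellAvg k x G ^ (1 / q)) := by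
  have hq0 : 0 < q := by linarith
  set μ := ENNReal.ofReal (((2 : ℝ) ^ k) ^ n) • (volume.restrict (dyadicCell k x)) with hμ
  have hprob : IsProbabilityMeasure μ := ⟨by
    rw [hμ, Measure.smul_apply, Measure.restrict_apply_univ, volume_dyadicCell, smul_eq_mul,
      ← ENNReal.ofReal_mul (by positivity), ← mul_pow, mul_inv_cancel₀ (by positivity)]
    simp⟩
  have hm : AEStronglyMeasurable (fun y => ENNReal.ofReal (G y ^ (1 / q))) μ :=
    ((hG.1.aemeasurable.pow_const _).ennreal_ofReal.smul_measure _).aestronglyMeasurable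
  have key := eLpNorm'_le_eLpNorm'_of_exponent_le one_pos hq μ hm
  simp only [eLpNorm', enorm_eq_self, ENNReal.rpow_one, div_one, hμ, lintegral_smul_measure,
    smul_eq_mul] at key
  refine key.trans (le_of_eq ?_)
  rw [← ENNReal.ofReal_rpow_of_nonneg (by
    unfold cellAvg; exact mul_nonneg (by positivity) (integral_nonneg h0)) (by positivity),
    ofReal_cellAvg hG h0]
  congr 2
  refine lintegral_congr fun y => ?_
  rw [ENNReal.ofReal_rpow_of_nonneg (Real.rpow_nonneg (h0 y) _) hq0.le, ← Real.rpow_mul (h0 y),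
    one_div_mul_cancel hq0.ne', Real.rpow_one]

/-- Oscillation of averages in terms of a majorant of the gradient. -/
lemma norm_cellAvg_succ_sub_le {F : EuclideanSpace ℝ (Fin n) → W}
    {D : EuclideanSpace ℝ (Fin n) → ℝ≥0∞} {q τ : ℝ} (hq : 1 ≤ q) (hτ : 0 ≤ τ)
    (hP : ‖cellAvg (k + 1) x F - cellAvg k x F‖ₑ ≤
      ENNReal.ofReal (2 ^ n * n * ((2 : ℝ) ^ k)⁻¹ * ((2 : ℝ) ^ k) ^ n) * ∫⁻ y in dyadicCell k x, D y)
    (hG : IntegrableOn G (dyadicCell k x)) (h0 : ∀ y, 0 ≤ G y)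
    (hD : ∀ y ∈ dyadicCell k x, D y ≤ ENNReal.ofReal (τ * G y ^ (1 / q))) :
    ‖cellAvg (k + 1) x F - cellAvg k x F‖ ≤
      2 ^ n * n * ((2 : ℝ) ^ k)⁻¹ * τ * cellAvg k x G ^ (1 / q) := by
  have hA : 0 ≤ cellAvg k x G := mul_nonneg (by positivity) (integral_nonneg h0)
  have hA' := Real.rpow_nonneg hA (1 / q)
  rw [← ENNReal.ofReal_le_ofReal_iff (by positivity), ofReal_norm]
  refine hP.trans ?_
  calc ENNReal.ofReal (2 ^ n * n * ((2 : ℝ) ^ k)⁻¹ * ((2 : ℝ) ^ k) ^ n) * ∫⁻ y in dyadicCell k x, D y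
      ≤ ENNReal.ofReal (2 ^ n * n * ((2 : ℝ) ^ k)⁻¹ * ((2 : ℝ) ^ k) ^ n) *
          (ENNReal.ofReal τ * ∫⁻ y in dyadicCell k x, ENNReal.ofReal (G y ^ (1 / q))) := by
        rw [← lintegral_const_mul' (ENNReal.ofReal τ) _ ENNReal.ofReal_ne_top]
        refine mul_le_mul' le_rfl (setLIntegral_mono' measurableSet_dyadicCell fun y hy => ?_)
        rw [← ENNReal.ofReal_mul hτ]
        exact hD y hy
    _ = ENNReal.ofReal (2 ^ n * n * ((2 : ℝ) ^ k)⁻¹ * τ) * (ENNReal.ofReal (((2 : ℝ) ^ k) ^ n) *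
          ∫⁻ y in dyadicCell k x, ENNReal.ofReal (G y ^ (1 / q))) := by
        rw [ENNReal.ofReal_mul (by positivity), ENNReal.ofReal_mul (q := τ) (by positivity)]
        ring
    _ ≤ ENNReal.ofReal (2 ^ n * n * ((2 : ℝ) ^ k)⁻¹ * τ) * ENNReal.ofReal (cellAvg k x G ^ (1 / q)) :=
        mul_le_mul' le_rfl (lintegral_rpow_inv_le_cellAvg hq hG h0)
    _ = _ := by rw [← ENNReal.ofReal_mul (by positivity)]

/-- The averages of a continuous function over shrinking dyadic cubes converge. -/
lemma tendsto_cellAvg [CompleteSpace W] {F : EuclideanSpace ℝ (Fin n) → W}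
    {V : Set (EuclideanSpace ℝ (Fin n))} (hV : V ∈ 𝓝 x) (hF : ContinuousOn F V) :
    Tendsto (fun k => cellAvg k x F) atTop (𝓝 (F x)) := by
  rw [Metric.tendsto_nhds]
  intro ε hε
  have hFx : ContinuousAt F x := hF.continuousAt hV
  obtain ⟨δ, hδ, hδV⟩ := Metric.nhds_basis_closedBall.mem_iff.1
    (Filter.inter_mem hV (Metric.continuousAt_iff'.1 hFx (ε / 2) (by positivity)))
  have hlim : Tendsto (fun k : ℕ => n * ((2 : ℝ) ^ k)⁻¹) atTop (𝓝 0) := by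
    have := (tendsto_pow_atTop_nhds_zero_of_lt_one (r := (2 : ℝ)⁻¹) (by norm_num)
      (by norm_num)).const_mul (n : ℝ)
    simpa using this
  filter_upwards [hlim.eventually_lt_const hδ] with k hk
  have hsub : dyadicCell k x ⊆ closedBall x δ :=
    dyadicCell_subset_closedBall.trans (closedBall_subset_closedBall hk.le)
  have hint : IntegrableOn F (dyadicCell k x) :=
    ((hF.mono (hδV.trans inter_subset_left)).integrableOn_compact
      (isCompact_closedBall x δ)).mono_set hsub
  rw [dist_eq_norm]
  refine (norm_cellAvg_sub_le hint fun y hy => ?_).trans_lt (half_lt_self hε)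
  rw [← dist_eq_norm]
  exact (hδV (hsub hy)).2.le

/-- The constant in Morrey's inequality on dyadic cubes. -/
def morreyConst (n : ℕ) (q : ℝ) : ℝ :=
  2 * (2 ^ n * n / (1 - 2 ^ (-(1 - n / q))))

lemma morreyConst_pos {q : ℝ} (hn : 0 < n) (hq : n < q) : 0 < morreyConst n q := by
  have hn' : (0 : ℝ) < n := by exact_mod_cast hn
  have h1 : (2 : ℝ) ^ (-(1 - n / q)) < 1 := by
    apply Real.rpow_lt_one_of_one_lt_of_neg (by norm_num)
    have : n / q < 1 := (div_lt_one (hn'.trans hq)).2 hq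
    linarith
  have : 0 < 1 - (2 : ℝ) ^ (-(1 - n / q)) := by linarith
  unfold morreyConst
  positivity

/-- Morrey's inequality on dyadic cubes. -/
lemma dist_le_of_mem_dyadicCell_of_hasWeakDerivOn [CompleteSpace W] {V : Set (EuclideanSpace ℝ (Fin n))}
    {f : EuclideanSpace ℝ (Fin n) → W}
    {Df : EuclideanSpace ℝ (Fin n) → (EuclideanSpace ℝ (Fin n) →L[ℝ] W)}
    (h : HasWeakDerivOn f Df V) (hf : ContinuousOn f V) (hVo : IsOpen V) {q : ℝ} (hn : 0 < n) (hq : n < q)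
    (hG : IntegrableOn G V) (h0 : ∀ y, 0 ≤ G y) (hD : ∀ y ∈ V, ‖Df y‖ ≤ G y ^ (1 / q))
    (hV : closedBall x (2 * (n * ((2 : ℝ) ^ k)⁻¹)) ⊆ V) {z : EuclideanSpace ℝ (Fin n)}
    (hy : y ∈ dyadicCell k x) (hz : z ∈ dyadicCell k x) :
    dist (f y) (f z) ≤ morreyConst n q * ((2 : ℝ) ^ k)⁻¹ * cellAvg k x G ^ (1 / q) := by
  have hn' : (1 : ℝ) ≤ n := by exact_mod_cast hn
  have hq0 : 0 < q := by linarith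
  have hA : 0 ≤ cellAvg k x G := mul_nonneg (by positivity) (integral_nonneg h0)
  set θ : ℝ := 2 ^ (-(1 - n / q)) with hθ
  have hθ1 : θ < 1 := by
    apply Real.rpow_lt_one_of_one_lt_of_neg (by norm_num)
    have : n / q < 1 := (div_lt_one hq0).2 hq
    linarith
  have hsub : ∀ w ∈ dyadicCell k x, ∀ j, k ≤ j → closedBall w (n * ((2 : ℝ) ^ j)⁻¹) ⊆ V := by
    intro w hw j hj
    refine (closedBall_subset_closedBall' ?_).trans hV
    have h1 := dist_le_of_mem_dyadicCell hw
    have h2 : ((2 : ℝ) ^ j)⁻¹ ≤ ((2 : ℝ) ^ k)⁻¹ := by gcongr; norm_num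
    nlinarith
  have hkx : IntegrableOn G (dyadicCell k x) :=
    hG.mono_set (dyadicCell_subset_closedBall.trans (hsub x mem_dyadicCell_self k le_rfl))
  have main : ∀ w ∈ dyadicCell k x, dist (cellAvg k x f) (f w) ≤
      (2 ^ n * n * ((2 : ℝ) ^ k)⁻¹ * cellAvg k x G ^ (1 / q)) / (1 - θ) := by
    intro w hw
    have hstep : ∀ i, dist (cellAvg (k + i) w f) (cellAvg (k + (i + 1)) w f) ≤
        (2 ^ n * n * ((2 : ℝ) ^ k)⁻¹ * cellAvg k x G ^ (1 / q)) * θ ^ i := by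
      intro i
      have hs := hsub w hw (k + i) (by omega)
      have hcell : dyadicCell (k + i) w ⊆ V := dyadicCell_subset_closedBall.trans hs
      have h1 := norm_cellAvg_succ_sub_le (q := q) (τ := 1) (by linarith) zero_le_one
        (h.enorm_cellAvg_succ_sub_le hf hVo hs) (hG.mono_set hcell) h0 (fun y hy => by
          rw [one_mul, ← ofReal_norm]
          exact ENNReal.ofReal_le_ofReal (hD y (hcell hy)))
      rw [dist_comm, dist_eq_norm, ← add_assoc]
      refine h1.trans ?_
      have h2 := cellAvg_le_of_mem hkx h0 (j := k + i) (by omega) hw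
      have h3 : cellAvg (k + i) w G ^ (1 / q) ≤ (2 : ℝ) ^ (i * (n / q)) * cellAvg k x G ^ (1 / q) := by
        refine (Real.rpow_le_rpow (mul_nonneg (by positivity) (integral_nonneg h0)) h2
          (by positivity)).trans (le_of_eq ?_)
        rw [Real.mul_rpow (by positivity) hA, Nat.add_sub_cancel_left, ← pow_mul,
          ← Real.rpow_natCast, ← Real.rpow_mul (by norm_num)]
        congr 2
        push_cast
        ring
      have h4 : θ ^ i = ((2 : ℝ) ^ i)⁻¹ * (2 : ℝ) ^ (i * (n / q)) := by
        rw [hθ, ← Real.rpow_natCast, ← Real.rpow_mul (by norm_num), ← Real.rpow_natCast,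
          ← Real.rpow_neg (by norm_num), ← Real.rpow_add (by norm_num)]
        congr 1
        ring
      calc 2 ^ n * n * ((2 : ℝ) ^ (k + i))⁻¹ * 1 * cellAvg (k + i) w G ^ (1 / q)
          ≤ 2 ^ n * n * ((2 : ℝ) ^ (k + i))⁻¹ * 1 *
            ((2 : ℝ) ^ (i * (n / q)) * cellAvg k x G ^ (1 / q)) := by gcongr
        _ = _ := by rw [h4, pow_add, mul_inv]; ring
    have hlim : Tendsto (fun i => cellAvg (k + i) w f) atTop (𝓝 (f w)) := by
      have hw' : V ∈ 𝓝 w := hVo.mem_nhds (hsub w hw k le_rfl (mem_closedBall_self (by positivity)))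
      have := (tendsto_cellAvg hw' hf).comp (tendsto_add_atTop_nat k)
      refine this.congr fun i => ?_
      simp [add_comm]
    have := dist_le_of_le_geometric_of_tendsto₀ θ _ hθ1 hstep hlim
    rwa [add_zero, cellAvg_eq_of_mem f hw] at this
  calc dist (f y) (f z) ≤ dist (cellAvg k x f) (f y) + dist (cellAvg k x f) (f z) :=
        dist_triangle_left _ _ _
    _ ≤ _ := add_le_add (main y hy) (main z hz)
    _ = _ := by rw [morreyConst]; ring

end CellAverages

section SelectedCells

variable {n : ℕ} {k j k₀ : ℕ} {x y : EuclideanSpace ℝ (Fin n)} {G : EuclideanSpace ℝ (Fin n) → ℝ}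
  {a : ℝ}

/-- The weight attached to the dyadic cube of level `k` containing `x`. -/
def cellWeight (G : EuclideanSpace ℝ (Fin n) → ℝ) (a : ℝ) (x : EuclideanSpace ℝ (Fin n)) (k : ℕ) : ℝ :=
  ((2 : ℝ) ^ k)⁻¹ * cellAvg k x G ^ (1 / a)

/-- Dyadic cubes whose weight dominates the damped weights of their ancestors. -/
def IsGoodCell (G : EuclideanSpace ℝ (Fin n) → ℝ) (a : ℝ) (k₀ k : ℕ) (x : EuclideanSpace ℝ (Fin n)) :
    Prop :=
  IsGoodIndex (3 / 4) k₀ (cellWeight G a x) k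

lemma cellWeight_eq_of_mem (h : y ∈ dyadicCell k x) : cellWeight G a y k = cellWeight G a x k := by
  rw [cellWeight, cellWeight, cellAvg_eq_of_mem G h]

lemma isGoodCell_iff_of_mem (h : y ∈ dyadicCell k x) :
    IsGoodCell G a k₀ k y ↔ IsGoodCell G a k₀ k x :=
  isGoodIndex_congr fun _ hj => cellWeight_eq_of_mem (dyadicCell_anti hj h)

lemma IsGoodCell.cellAvg_rpow_le (h : IsGoodCell G a k₀ k x) (ha : 0 < a) (h0 : ∀ y, 0 ≤ G y)
    (hj : k₀ ≤ j) (hjk : j ≤ k) {e : ℝ} (he : 0 ≤ e) :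
    cellAvg j x G ^ e ≤ ((2 / 3 : ℝ) ^ (a * e)) ^ (k - j) * cellAvg k x G ^ e := by
  have hA : ∀ i, 0 ≤ cellAvg i x G := fun i => mul_nonneg (by positivity) (integral_nonneg h0)
  have h1 := h j hj hjk
  unfold cellWeight at h1
  have h2 : cellAvg j x G ^ (1 / a) ≤ (2 / 3 : ℝ) ^ (k - j) * cellAvg k x G ^ (1 / a) := by
    have h3 : ((2 : ℝ) ^ k) = 2 ^ (k - j) * 2 ^ j := by rw [← pow_add, Nat.sub_add_cancel hjk]
    have h4 : (4 / 3 : ℝ) ^ (k - j) * 2 ^ j * ((3 / 4) ^ (k - j) * ((2 ^ j)⁻¹ * cellAvg j x G ^ (1 / a)))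
        ≤ (4 / 3 : ℝ) ^ (k - j) * 2 ^ j * ((2 ^ k)⁻¹ * cellAvg k x G ^ (1 / a)) := by gcongr
    have h5 : (4 / 3 : ℝ) ^ (k - j) * (3 / 4) ^ (k - j) = 1 := by rw [← mul_pow]; norm_num
    have h6 : (2 / 3 : ℝ) ^ (k - j) = (4 / 3 : ℝ) ^ (k - j) * ((2 : ℝ) ^ (k - j))⁻¹ := by
      rw [← inv_pow, ← mul_pow]; norm_num
    have h7 : (2 : ℝ) ^ j * ((2 : ℝ) ^ j)⁻¹ = 1 := mul_inv_cancel₀ (by positivity)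
    calc cellAvg j x G ^ (1 / a) = ((4 / 3 : ℝ) ^ (k - j) * (3 / 4) ^ (k - j)) *
          ((2 : ℝ) ^ j * ((2 : ℝ) ^ j)⁻¹) * cellAvg j x G ^ (1 / a) := by rw [h5, h7]; ring
      _ ≤ _ := by refine (le_of_eq ?_).trans h4; ring
      _ = ((2 : ℝ) ^ j * ((2 : ℝ) ^ j)⁻¹) * ((4 / 3 : ℝ) ^ (k - j) * ((2 : ℝ) ^ (k - j))⁻¹) *
          cellAvg k x G ^ (1 / a) := by rw [h3, mul_inv]; ring
      _ = _ := by rw [h7, h6]; ring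
  have h8 := Real.rpow_le_rpow (Real.rpow_nonneg (hA j) _) h2 (mul_nonneg ha.le he)
  rw [Real.mul_rpow (by positivity) (Real.rpow_nonneg (hA k) _), ← Real.rpow_mul (hA j),
    ← Real.rpow_mul (hA k), show 1 / a * (a * e) = e by field_simp] at h8
  refine h8.trans (le_of_eq ?_)
  rw [← Real.rpow_natCast, ← Real.rpow_natCast, ← Real.rpow_mul (by norm_num),
    ← Real.rpow_mul (by norm_num), mul_comm (a * e)]

lemma sum_lintegral_le_lintegral_sum {α ι : Type*} [MeasurableSpace α] {μ : Measure α} (S : Finset ι)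
    (F : ι → α → ℝ≥0∞) : ∑ i ∈ S, ∫⁻ y, F i y ∂μ ≤ ∫⁻ y, ∑ i ∈ S, F i y ∂μ := by
  classical
  induction S using Finset.induction_on with
  | empty => simp
  | insert i S hi ih =>
    simp only [Finset.sum_insert hi]
    exact (add_le_add le_rfl ih).trans (le_lintegral_add _ _)

open Classical in
lemma ofReal_volume_mul_cellAvg_rpow_le {V : Set (EuclideanSpace ℝ (Fin n))} (hG : IntegrableOn G V)
    (h0 : ∀ y, 0 ≤ G y) {σ : ℝ} (hcell : dyadicCell k x ⊆ V)
    (hA : 0 < cellAvg k x G) :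
    ENNReal.ofReal ((((2 : ℝ) ^ k)⁻¹) ^ n * cellAvg k x G ^ σ) ≤
      ∫⁻ y in V, if y ∈ dyadicCell k x ∧ cellAvg k x G ≤ 2 * G y then
        ENNReal.ofReal (2 * (G y * cellAvg k x G ^ (σ - 1))) else 0 := by
  set A := cellAvg k x G with hAdef
  set Q := dyadicCell k x with hQ
  have hQm : MeasurableSet Q := measurableSet_dyadicCell
  have hGQ : IntegrableOn G Q := hG.mono_set hcell
  have hv : (((2 : ℝ) ^ k)⁻¹) ^ n * ((2 : ℝ) ^ k) ^ n = 1 := by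
    rw [← mul_pow, inv_mul_cancel₀ (by positivity), one_pow]
  have h1 : ENNReal.ofReal ((((2 : ℝ) ^ k)⁻¹) ^ n * A) = ∫⁻ y in Q, ENNReal.ofReal (G y) := by
    rw [ENNReal.ofReal_mul (by positivity), hAdef, ofReal_cellAvg hGQ h0, ← mul_assoc,
      ← ENNReal.ofReal_mul (by positivity), hv, ENNReal.ofReal_one, one_mul]
  set I := ∫⁻ y in Q, if A ≤ 2 * G y then ENNReal.ofReal (G y) else 0 with hI
  have h2 : ENNReal.ofReal ((((2 : ℝ) ^ k)⁻¹) ^ n * A) ≤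
      I + ENNReal.ofReal ((((2 : ℝ) ^ k)⁻¹) ^ n * A / 2) := by
    have h3 : ENNReal.ofReal ((((2 : ℝ) ^ k)⁻¹) ^ n * A / 2) = ∫⁻ _y in Q, ENNReal.ofReal (A / 2) := by
      rw [setLIntegral_const, volume_dyadicCell, ← ENNReal.ofReal_mul (by positivity)]
      congr 1; ring
    rw [h1, h3, hI, ← lintegral_add_right _ measurable_const]
    refine lintegral_mono fun y => ?_
    dsimp only
    split_ifs with hy
    · exact le_self_add
    · rw [zero_add]
      exact ENNReal.ofReal_le_ofReal (by linarith)
  have h4 : ENNReal.ofReal ((((2 : ℝ) ^ k)⁻¹) ^ n * A / 2) ≤ I := by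
    have h5 : ENNReal.ofReal ((((2 : ℝ) ^ k)⁻¹) ^ n * A) =
        ENNReal.ofReal ((((2 : ℝ) ^ k)⁻¹) ^ n * A / 2) + ENNReal.ofReal ((((2 : ℝ) ^ k)⁻¹) ^ n * A / 2) := by
      rw [← ENNReal.ofReal_add (by positivity) (by positivity), add_halves]
    rw [h5] at h2
    exact (ENNReal.add_le_add_iff_right ENNReal.ofReal_ne_top).1 h2
  have h6 : A ^ σ = A * A ^ (σ - 1) := by
    rw [Real.rpow_sub_one hA.ne', mul_div_cancel₀ _ hA.ne']
  calc ENNReal.ofReal ((((2 : ℝ) ^ k)⁻¹) ^ n * A ^ σ)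
      = ENNReal.ofReal (2 * A ^ (σ - 1)) * ENNReal.ofReal ((((2 : ℝ) ^ k)⁻¹) ^ n * A / 2) := by
        rw [← ENNReal.ofReal_mul (by positivity), h6]
        congr 1; ring
    _ ≤ ENNReal.ofReal (2 * A ^ (σ - 1)) * I := mul_le_mul' le_rfl h4
    _ = ∫⁻ y in V, Q.indicator (fun y => ENNReal.ofReal (2 * A ^ (σ - 1)) *
          if A ≤ 2 * G y then ENNReal.ofReal (G y) else 0) y := by
        rw [lintegral_indicator hQm, Measure.restrict_restrict hQm, inter_eq_left.2 hcell, hI,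
          lintegral_const_mul' _ _ ENNReal.ofReal_ne_top]
    _ ≤ _ := by
        refine lintegral_mono fun y => ?_
        by_cases hy : y ∈ Q
        · by_cases hy2 : A ≤ 2 * G y
          · simp only [indicator_of_mem hy, hy, hy2, true_and, if_true]
            rw [← ENNReal.ofReal_mul (by positivity)]
            exact ENNReal.ofReal_le_ofReal (le_of_eq (by ring))
          · simp [hy2]
        · simp [hy]

/-- A Carleson-type packing estimate for good dyadic cubes. -/
lemma sum_goodCell_le {V : Set (EuclideanSpace ℝ (Fin n))} (hG : IntegrableOn G V)
    (h1 : ∀ y, 1 ≤ G y) (ha : 0 < a) {σ : ℝ} (hσ : 1 < σ)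
    {P : Finset (ℕ × EuclideanSpace ℝ (Fin n))}
    (hP : ∀ p ∈ P, dyadicCorner p.1 p.2 = p.2 ∧ k₀ ≤ p.1 ∧ dyadicCell p.1 p.2 ⊆ V ∧
      IsGoodCell G a k₀ p.1 p.2) :
    ∑ p ∈ P, ENNReal.ofReal ((((2 : ℝ) ^ p.1)⁻¹) ^ n * cellAvg p.1 p.2 G ^ σ) ≤
      ENNReal.ofReal (2 ^ σ * (1 - (2 / 3 : ℝ) ^ (a * (σ - 1)))⁻¹) * ∫⁻ y in V, ENNReal.ofReal (G y ^ σ) := by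
  classical
  have h0 : ∀ y, 0 ≤ G y := fun y => zero_le_one.trans (h1 y)
  have hA : ∀ p ∈ P, 0 < cellAvg p.1 p.2 G := fun p hp =>
    zero_lt_one.trans_le (one_le_cellAvg (hG.mono_set (hP p hp).2.2.1) h1)
  set ρ : ℝ := (2 / 3 : ℝ) ^ (a * (σ - 1)) with hρ
  have hρ0 : 0 ≤ ρ := by positivity
  have hρ1 : ρ < 1 := Real.rpow_lt_one (by norm_num) (by norm_num) (mul_pos ha (by linarith))
  have hρ2 : 0 < 1 - ρ := by linarith
  rw [← lintegral_const_mul' _ _ ENNReal.ofReal_ne_top]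
  refine (Finset.sum_le_sum fun p hp => ofReal_volume_mul_cellAvg_rpow_le hG h0
    (hP p hp).2.2.1 (hA p hp)).trans ((sum_lintegral_le_lintegral_sum _ _).trans
    (lintegral_mono fun y => ?_))
  rw [← Finset.sum_filter, ← ENNReal.ofReal_sum_of_nonneg, ← ENNReal.ofReal_mul (by positivity)]
  swap
  · intro p hp
    have := (hA p (Finset.mem_filter.1 hp).1).le
    have := h0 y
    positivity
  refine ENNReal.ofReal_le_ofReal ?_
  set S := P.filter fun p => y ∈ dyadicCell p.1 p.2 ∧ cellAvg p.1 p.2 G ≤ 2 * G y with hS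
  have hSA : ∀ p ∈ S, cellAvg p.1 p.2 G = cellAvg p.1 y G := fun p hp =>
    (cellAvg_eq_of_mem G (Finset.mem_filter.1 hp).2.1).symm
  have hinj : Set.InjOn Prod.fst (S : Set (ℕ × EuclideanSpace ℝ (Fin n))) := by
    intro p hp p' hp' hpp
    have h2 := Finset.mem_filter.1 hp
    have h3 := Finset.mem_filter.1 hp'
    refine Prod.ext hpp ?_
    rw [← (hP p h2.1).1, ← (hP p' h3.1).1, ← dyadicCorner_eq_of_mem h2.2.1,
      ← dyadicCorner_eq_of_mem h3.2.1, hpp]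
  have hsum : ∑ p ∈ S, cellAvg p.1 p.2 G ^ (σ - 1) ≤ (1 - ρ)⁻¹ * (2 * G y) ^ (σ - 1) := by
    rw [Finset.sum_congr rfl fun p hp => by rw [hSA p hp],
      ← Finset.sum_image (f := fun k => cellAvg k y G ^ (σ - 1)) hinj]
    have hSk : ∀ k ∈ S.image Prod.fst, k₀ ≤ k ∧ IsGoodCell G a k₀ k y ∧ cellAvg k y G ≤ 2 * G y := by
      intro k hk
      obtain ⟨p, hp, rfl⟩ := Finset.mem_image.1 hk
      have h2 := Finset.mem_filter.1 hp
      refine ⟨(hP p h2.1).2.1, (isGoodCell_iff_of_mem h2.2.1).2 (hP p h2.1).2.2.2, ?_⟩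
      rw [← hSA p hp]
      exact h2.2.2
    refine sum_le_of_geometric_growth hρ0 hρ1
      (Real.rpow_nonneg (mul_nonneg zero_le_two (h0 y)) _) ?_ ?_
    · intro j hj k hk hjk
      exact (hSk k hk).2.1.cellAvg_rpow_le ha h0 (hSk j hj).1 hjk (by linarith)
    · intro k hk
      exact Real.rpow_le_rpow (mul_nonneg (by positivity) (integral_nonneg h0)) (hSk k hk).2.2
        (by linarith)
  calc ∑ p ∈ S, 2 * (G y * cellAvg p.1 p.2 G ^ (σ - 1))
      = 2 * G y * ∑ p ∈ S, cellAvg p.1 p.2 G ^ (σ - 1) := by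
        rw [Finset.mul_sum]; exact Finset.sum_congr rfl fun _ _ => by ring
    _ ≤ 2 * G y * ((1 - ρ)⁻¹ * (2 * G y) ^ (σ - 1)) := by
        have := h0 y
        gcongr
    _ = (1 - ρ)⁻¹ * ((2 * G y) * (2 * G y) ^ (σ - 1)) := by ring
    _ = (1 - ρ)⁻¹ * (2 * G y) ^ σ := by
        have hy : 0 < 2 * G y := by linarith [h1 y]
        rw [← Real.rpow_one_add' hy.le (by linarith)]; congr 2; ring
    _ = _ := by rw [Real.mul_rpow zero_le_two (h0 y)]; ring

end SelectedCells

/-- A function that is Lipschitz at scale `δ` with variable constant `L y` is uniformly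
approximated by smooth functions whose gradient is bounded by `L`. -/
theorem exists_contDiff_norm_fderiv_le {n : ℕ} {w L : EuclideanSpace ℝ (Fin n) → ℝ}
    {δ M ε : ℝ} (hδ : 0 < δ) (hε : 0 < ε) (h0 : ∀ y, 0 ≤ L y) (hM : ∀ y, L y ≤ M)
    (hL : ∀ y, ∀ y₁ ∈ ball y δ, ∀ y₂ ∈ ball y δ, |w y₁ - w y₂| ≤ L y * dist y₁ y₂) :
    ∃ W : EuclideanSpace ℝ (Fin n) → ℝ, ContDiff ℝ (⊤ : ℕ∞) W ∧
      (∀ y, |W y - w y| ≤ ε) ∧ (∀ y, (∀ z ∈ ball y δ, w z = 0) → W y = 0) ∧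
      ∀ y, ‖fderiv ℝ W y‖ ≤ L y := by
  have hM0 : 0 ≤ M := (h0 0).trans (hM 0)
  have hw : Continuous w := by
    refine continuous_iff_continuousAt.2 fun y => ?_
    refine tendsto_iff_dist_tendsto_zero.2 ?_
    refine squeeze_zero' (g := fun z => L y * dist z y) (Eventually.of_forall fun _ => dist_nonneg)
      ?_ ?_
    · filter_upwards [ball_mem_nhds y hδ] with z hz
      exact hL y z hz y (mem_ball_self hδ)
    · have : Tendsto (fun z => L y * dist z y) (𝓝 y) (𝓝 (L y * dist y y)) :=
        (continuous_const.mul (continuous_id.dist continuous_const)).tendsto y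
      simpa using this
  set ρ : ℝ := min (δ / 2) (ε / (M + 1)) with hρ
  have hρ0 : 0 < ρ := by positivity
  have hρδ : ρ ≤ δ / 2 := min_le_left _ _
  have hρε : M * ρ ≤ ε := by
    have h1 : ρ ≤ ε / (M + 1) := min_le_right _ _
    have h2 : ρ * (M + 1) ≤ ε := (le_div_iff₀ (by positivity)).1 h1
    nlinarith
  let φ : ContDiffBump (0 : EuclideanSpace ℝ (Fin n)) := ⟨ρ / 2, ρ, by positivity, by linarith⟩
  have hφc : HasCompactSupport (φ.normed volume) := φ.hasCompactSupport_normed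
  have hloc : LocallyIntegrable w volume := hw.locallyIntegrable
  refine ⟨convolution (φ.normed volume) w (ContinuousLinearMap.lsmul ℝ ℝ) volume,
    hφc.contDiff_convolution_left _ φ.contDiff_normed hloc, fun y => ?_, fun y hy => ?_,
    fun y => ?_⟩
  · rw [← Real.dist_eq]
    refine φ.dist_normed_convolution_le hw.aestronglyMeasurable fun z hz => ?_
    have hz' : dist z y < ρ := hz
    rw [Real.dist_eq]
    calc |w z - w y| ≤ L y * dist z y :=
          hL y z (mem_ball.2 (by linarith)) y (mem_ball_self hδ)
      _ ≤ M * ρ := mul_le_mul (hM y) hz'.le dist_nonneg hM0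
      _ ≤ ε := hρε
  · have h1 : dist (convolution (φ.normed volume) w (ContinuousLinearMap.lsmul ℝ ℝ) volume y)
        (w y) ≤ 0 := by
      refine φ.dist_normed_convolution_le hw.aestronglyMeasurable fun z hz => ?_
      have hz' : dist z y < ρ := hz
      rw [hy z (mem_ball.2 (by linarith)), hy y (mem_ball_self hδ), dist_self]
    rw [dist_le_zero.1 h1, hy y (mem_ball_self hδ)]
  · refine norm_fderiv_le_of_lip' ℝ (h0 y) ?_
    filter_upwards [ball_mem_nhds y (half_pos hδ)] with z hz
    have hz' : dist z y < δ / 2 := hz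
    have hex : ConvolutionExists (φ.normed volume) w (ContinuousLinearMap.lsmul ℝ ℝ) volume :=
      hφc.convolutionExists_left _ (φ.contDiff_normed (n := 0)).continuous hloc
    have hsub : convolution (φ.normed volume) w (ContinuousLinearMap.lsmul ℝ ℝ) volume z -
        convolution (φ.normed volume) w (ContinuousLinearMap.lsmul ℝ ℝ) volume y =
        ∫ t, φ.normed volume t * (w (z - t) - w (y - t)) := by
      rw [convolution_def, convolution_def, ← integral_sub (hex z) (hex y)]
      refine integral_congr_ae (Eventually.of_forall fun t => ?_)
      simp [mul_sub]
    rw [hsub, ← dist_eq_norm]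
    have hint : Integrable (fun t => φ.normed volume t * (L y * dist z y)) volume :=
      φ.integrable_normed.mul_const _
    refine (norm_integral_le_of_norm_le hint (Eventually.of_forall fun t => ?_)).trans_eq ?_
    · by_cases ht : t ∈ ball (0 : EuclideanSpace ℝ (Fin n)) ρ
      · have ht' : ‖t‖ < ρ := by simpa using ht
        rw [norm_mul, Real.norm_of_nonneg (φ.nonneg_normed t)]
        refine mul_le_mul_of_nonneg_left ?_ (φ.nonneg_normed t)
        have h1 : dist (y - t) y < δ / 2 := by
          rw [dist_eq_norm, sub_sub_cancel_left, norm_neg]; linarith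
        have h2 : dist (z - t) (y - t) = dist z y := dist_sub_right _ _ _
        have h3 := dist_triangle (z - t) (y - t) y
        have := hL y (z - t) (mem_ball.2 (by linarith)) (y - t) (mem_ball.2 (by linarith))
        rwa [h2] at this
      · have : φ.normed volume t = 0 := by
          rw [← φ.support_normed_eq (μ := volume)] at ht
          simpa using ht
        simp [this]
    · rw [integral_mul_const, φ.integral_normed, one_mul]

theorem exists_abs_deriv_smoothTransition_le :
    ∃ C : ℝ, 0 < C ∧ ∀ x, |deriv Real.smoothTransition x| ≤ C := by
  have hc : Continuous (deriv Real.smoothTransition) :=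
    (Real.smoothTransition.contDiff (n := 1)).continuous_deriv le_rfl
  obtain ⟨C, hC⟩ := (isCompact_Icc (a := (0 : ℝ)) (b := 1)).exists_bound_of_continuousOn
    hc.continuousOn
  refine ⟨max C 1, by positivity, fun x => ?_⟩
  by_cases hx : x ∈ Icc (0 : ℝ) 1
  · exact (hC x hx).trans (le_max_left _ _)
  · have : deriv Real.smoothTransition x = 0 := by
      rcases not_and_or.1 hx with h | h
      · have : Real.smoothTransition =ᶠ[𝓝 x] fun _ => 0 := by
          filter_upwards [Iio_mem_nhds (not_le.1 h)] with y hy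
          exact Real.smoothTransition.zero_of_nonpos (le_of_lt hy)
        rw [this.deriv_eq, deriv_const]
      · have : Real.smoothTransition =ᶠ[𝓝 x] fun _ => 1 := by
          filter_upwards [Ioi_mem_nhds (not_le.1 h)] with y hy
          exact Real.smoothTransition.one_of_one_le (le_of_lt hy)
        rw [this.deriv_eq, deriv_const]
    rw [this, abs_zero]; positivity

/-- The capacity is controlled by functions that are Lipschitz at some scale. -/
theorem exists_sobCap_le (n : ℕ) {r : ℝ} (hr : 0 < r) :
    ∃ C : ℝ, 0 < C ∧ ∀ (F U K : Set (EuclideanSpace ℝ (Fin n)))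
      (w L : EuclideanSpace ℝ (Fin n) → ℝ) (S δ M : ℝ), IsOpen U → IsCompact K → K ⊆ U →
      0 < S → 0 < δ → (∀ y ∈ F, S ≤ w y) → (∀ y ∉ K, w y = 0) → (∀ y, 0 ≤ L y) →
      (∀ y, L y ≤ M) →
      (∀ y, ∀ y₁ ∈ ball y δ, ∀ y₂ ∈ ball y δ, |w y₁ - w y₂| ≤ L y * dist y₁ y₂) →
      sobCap n r F U ≤ ENNReal.ofReal ((C / S) ^ r) * ∫⁻ y, ENNReal.ofReal (L y ^ r) := by
  obtain ⟨C₀, hC₀, hC⟩ := exists_abs_deriv_smoothTransition_le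
  refine ⟨2 * C₀, by positivity, fun F U K w L S δ M hU hK hKU hS hδ hwF hwK h0 hM hL => ?_⟩
  obtain ⟨δ₁, hδ₁, hKδ⟩ := hK.exists_cthickening_subset_open hU hKU
  set δ' := min δ δ₁ with hδ'
  have hδ'0 : 0 < δ' := by positivity
  obtain ⟨W, hW, hWw, hWz, hWd⟩ := exists_contDiff_norm_fderiv_le hδ'0
    (show 0 < S / 4 by positivity) h0 hM
    (fun y y₁ h₁ y₂ h₂ => hL y y₁ (ball_subset_ball (min_le_left _ _) h₁) y₂
      (ball_subset_ball (min_le_left _ _) h₂))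
  have hWout : ∀ y ∉ cthickening δ₁ K, W y = 0 := fun y hy => by
    refine hWz y fun z hz => hwK z fun hzK => hy ?_
    refine mem_cthickening_of_dist_le y z δ₁ K hzK ?_
    rw [dist_comm]
    exact (mem_ball.1 hz).le.trans (min_le_right _ _)
  set u : EuclideanSpace ℝ (Fin n) → ℝ := fun y => Real.smoothTransition (2 / S * W y) with hu
  have huout : ∀ y ∉ cthickening δ₁ K, u y = 0 := fun y hy => by
    simp [hu, hWout y hy]
  have hts : tsupport u ⊆ cthickening δ₁ K :=
    closure_minimal (fun y hy => by_contra fun h => hy (huout y h)) isClosed_cthickening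
  have hud : ContDiff ℝ (⊤ : ℕ∞) u :=
    Real.smoothTransition.contDiff.comp (contDiff_const.mul hW)
  have hfd : ∀ y, ‖fderiv ℝ u y‖ ≤ 2 * C₀ / S * L y := fun y => by
    have h1 : HasFDerivAt W (fderiv ℝ W y) y :=
      (hW.differentiable (by simp)).differentiableAt.hasFDerivAt
    have h2 : HasDerivAt Real.smoothTransition (deriv Real.smoothTransition (2 / S * W y))
        (2 / S * W y) :=
      ((Real.smoothTransition.contDiff (n := 1)).differentiable
        (by simp)).differentiableAt.hasDerivAt
    have h3 := h2.comp_hasFDerivAt y (h1.const_mul (2 / S))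
    have h4 : fderiv ℝ u y = deriv Real.smoothTransition (2 / S * W y) •
        ((2 / S) • fderiv ℝ W y) := h3.fderiv
    rw [h4, norm_smul, norm_smul, Real.norm_eq_abs, Real.norm_of_nonneg (by positivity)]
    calc _ ≤ C₀ * (2 / S * L y) := by
          gcongr
          · exact hC _
          · exact hWd y
      _ = _ := by ring
  have hmem : sobCap n r F U ≤ ∫⁻ x in U, ENNReal.ofReal (‖fderiv ℝ u x‖ ^ r) := by
    refine sInf_le ⟨u, hud, hK.cthickening.of_isClosed_subset (isClosed_tsupport u) hts,
      hts.trans hKδ, ⟨{y | S / 2 < W y}, isOpen_lt continuous_const hW.continuous, ?_, ?_⟩, rfl⟩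
    · intro y hy
      have h1 := hwF y hy
      have h2 := abs_le.1 (hWw y)
      show S / 2 < W y
      linarith [h2.1]
    · intro y hy
      have hy' : S / 2 < W y := hy
      refine Real.smoothTransition.one_of_one_le ?_
      rw [div_mul_eq_mul_div, le_div_iff₀ hS]; linarith
  refine hmem.trans ?_
  calc ∫⁻ x in U, ENNReal.ofReal (‖fderiv ℝ u x‖ ^ r)
      ≤ ∫⁻ x, ENNReal.ofReal (‖fderiv ℝ u x‖ ^ r) := setLIntegral_le_lintegral _ _
    _ ≤ ∫⁻ y, ENNReal.ofReal ((2 * C₀ / S) ^ r) * ENNReal.ofReal (L y ^ r) := by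
        refine lintegral_mono fun y => ?_
        rw [← ENNReal.ofReal_mul (by positivity), ← Real.mul_rpow (by positivity) (h0 y)]
        exact ENNReal.ofReal_le_ofReal
          (Real.rpow_le_rpow (norm_nonneg _) (hfd y) hr.le)
    _ = _ := lintegral_const_mul' _ _ ENNReal.ofReal_ne_top

/-- Truncation of a real number to the unit interval. -/
def clip (t : ℝ) : ℝ := max 0 (min 1 t)

theorem clip_of_nonpos {t : ℝ} (h : t ≤ 0) : clip t = 0 :=
  max_eq_left ((min_le_right _ _).trans h)

theorem clip_of_one_le {t : ℝ} (h : 1 ≤ t) : clip t = 1 := by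
  simp [clip, min_eq_left h]

theorem abs_clip_sub_clip_le (s t : ℝ) : |clip s - clip t| ≤ |s - t| := by
  unfold clip
  refine (abs_max_sub_max_le_max 0 (min 1 s) 0 (min 1 t)).trans ?_
  refine max_le (by simp) ((abs_min_sub_min_le_max 1 s 1 t).trans (max_le (by simp) le_rfl))

theorem card_filter_abs_le (m : ℕ) (t : ℝ) :
    ((Finset.range m).filter fun i : ℕ => t - 4 ≤ i ∧ (i : ℝ) ≤ t - 1).card ≤ 4 := by
  have : ((Finset.range m).filter fun i : ℕ => t - 4 ≤ i ∧ (i : ℝ) ≤ t - 1) ⊆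
      Finset.Icc ⌈t - 4⌉₊ (⌈t - 4⌉₊ + 3) := by
    intro i hi
    obtain ⟨-, h1, h2⟩ := Finset.mem_filter.1 hi
    refine Finset.mem_Icc.2 ⟨Nat.ceil_le.2 h1, ?_⟩
    have := Nat.le_ceil (t - 4)
    have h3 : (i : ℝ) ≤ (⌈t - 4⌉₊ + 3 : ℕ) := by push_cast; linarith
    exact_mod_cast h3
  refine (Finset.card_le_card this).trans_eq ?_
  rw [Nat.card_Icc]
  omega

theorem mem_cthickening_of_infDist_le {X : Type*} [PseudoMetricSpace X] {F : Set X}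
    (hF : F.Nonempty) {δ : ℝ} {y : X} (h : infDist y F ≤ δ) : y ∈ cthickening δ F := by
  rw [mem_cthickening_iff, ← ENNReal.ofReal_toReal (infEDist_ne_top hF (x := y))]
  exact ENNReal.ofReal_le_ofReal h

/-- Below exponent one every compact set has vanishing capacity. -/
theorem sobCap_eq_zero_of_lt_one {n : ℕ} {r : ℝ} (hr : 0 < r) (hr1 : r < 1)
    {F U : Set (EuclideanSpace ℝ (Fin n))} (hF : IsCompact F) (hU : IsOpen U) (hFU : F ⊆ U) :
    sobCap n r F U = 0 := by
  classical
  obtain ⟨C, hC, hcap⟩ := exists_sobCap_le n hr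
  rcases F.eq_empty_or_nonempty with rfl | hne
  · have := hcap ∅ U ∅ (fun _ => 0) (fun _ => 0) 1 1 0 hU isCompact_empty (empty_subset _)
      one_pos one_pos (by simp) (by simp) (by simp) (by simp) (by simp)
    simpa [Real.zero_rpow hr.ne'] using this
  obtain ⟨δ, hδ, hFδ⟩ := hF.exists_cthickening_subset_open hU hFU
  set K := cthickening δ F with hK
  have hKc : IsCompact K := hF.cthickening
  set d : EuclideanSpace ℝ (Fin n) → ℝ := fun y => 1 - infDist y F / δ with hd
  have hdF : ∀ y ∈ F, d y = 1 := fun y hy => by simp [hd, infDist_zero_of_mem hy]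
  have hdK : ∀ y, y ∉ K → d y < 0 := fun y hy => by
    have h1 : δ < infDist y F := not_le.1 fun h => hy (mem_cthickening_of_infDist_le hne h)
    have h2 : 1 < infDist y F / δ := (one_lt_div hδ).2 h1
    simp only [hd]; linarith
  have hdL : ∀ y z, |d y - d z| ≤ dist y z / δ := fun y z => by
    have h1 : |infDist y F - infDist z F| ≤ dist y z := by
      have := (lipschitz_infDist_pt F).dist_le_mul y z
      simpa [Real.dist_eq] using this
    have h2 : d y - d z = -((infDist y F - infDist z F) / δ) := by simp only [hd]; ring
    rw [h2, abs_neg, abs_div, abs_of_pos hδ]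
    gcongr
  set A : ℝ := C ^ r * (4 * (4 / δ) ^ r) * volume.real K with hA
  have key : ∀ m : ℕ, 1 ≤ m → sobCap n r F U ≤ ENNReal.ofReal (A * (m : ℝ) ^ (-(1 - r))) := by
    intro m hm
    set j : ℝ := m + 3 with hj
    have hj0 : 0 < j := by positivity
    have hm0 : (0 : ℝ) < m := by exact_mod_cast hm
    set L : ℕ → EuclideanSpace ℝ (Fin n) → ℝ := fun i y =>
      if j * d y - 4 ≤ i ∧ (i : ℝ) ≤ j * d y - 1 then j / δ else 0 with hL
    have hL0 : ∀ i y, 0 ≤ L i y := fun i y => by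
      simp only [hL]; split_ifs <;> positivity
    have h1 : ∀ i ∈ Finset.range m, sobCap n r F U ≤
        ENNReal.ofReal (C ^ r) * ∫⁻ y, ENNReal.ofReal (L i y ^ r) := by
      intro i hi
      have him : (i : ℝ) ≤ m := by exact_mod_cast (Finset.mem_range.1 hi).le
      have hi0 : (0 : ℝ) ≤ i := by positivity
      have := hcap F U K (fun y => clip (j * d y - (i + 2))) (L i) 1 (δ / j) (j / δ) hU hKc hFδ
        one_pos (by positivity) (fun y hy => ?_) (fun y hy => ?_) (hL0 i) (fun y => ?_)
        (fun y y₁ h₁ y₂ h₂ => ?_)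
      · simpa using this
      · rw [clip_of_one_le]; rw [hdF y hy]; simp only [hj]; linarith
      · rw [clip_of_nonpos]; nlinarith [hdK y hy]
      · simp only [hL]; split_ifs
        · exact le_rfl
        · positivity
      · have hb : ∀ z ∈ ball y (δ / j), |j * d z - j * d y| ≤ 1 := fun z hz => by
          rw [← mul_sub, abs_mul, abs_of_pos hj0]
          calc j * |d z - d y| ≤ j * (δ / j / δ) := by
                gcongr
                exact (hdL z y).trans (by gcongr; exact (mem_ball.1 hz).le)
            _ = 1 := by field_simp
        have b₁ := abs_le.1 (hb y₁ h₁)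
        have b₂ := abs_le.1 (hb y₂ h₂)
        simp only [hL]
        split_ifs with hc
        · refine (abs_clip_sub_clip_le _ _).trans ?_
          have : j * d y₁ - (i + 2) - (j * d y₂ - (i + 2)) = j * (d y₁ - d y₂) := by ring
          rw [this, abs_mul, abs_of_pos hj0]
          calc j * |d y₁ - d y₂| ≤ j * (dist y₁ y₂ / δ) := by gcongr; exact hdL _ _
            _ = _ := by ring
        · rcases not_and_or.1 hc with h | h
          · rw [clip_of_one_le (by linarith [b₁.1]), clip_of_one_le (by linarith [b₂.1])]
            simp
          · rw [clip_of_nonpos (by linarith [b₁.2]), clip_of_nonpos (by linarith [b₂.2])]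
            simp
    have h2 : ∀ y, ∑ i ∈ Finset.range m, ENNReal.ofReal (L i y ^ r) ≤
        K.indicator (fun _ => ENNReal.ofReal (4 * (j / δ) ^ r)) y := by
      intro y
      by_cases hy : y ∈ K
      · rw [indicator_of_mem hy]
        have hp : ∀ i, L i y ^ r =
            if j * d y - 4 ≤ (i : ℝ) ∧ (i : ℝ) ≤ j * d y - 1 then (j / δ) ^ r else 0 := by
          intro i; simp only [hL]; split_ifs
          · rfl
          · exact Real.zero_rpow hr.ne'
        rw [← ENNReal.ofReal_sum_of_nonneg fun i _ => Real.rpow_nonneg (hL0 i y) r]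
        refine ENNReal.ofReal_le_ofReal ?_
        simp_rw [hp]
        rw [← Finset.sum_filter, Finset.sum_const, nsmul_eq_mul]
        gcongr
        exact_mod_cast card_filter_abs_le m (j * d y)
      · rw [indicator_of_notMem hy]
        refine (Finset.sum_eq_zero fun i _ => ?_).le
        have : L i y = 0 := by
          simp only [hL]
          refine if_neg fun h => ?_
          have h3 := hdK y hy
          have hi0 : (0 : ℝ) ≤ i := by positivity
          nlinarith [h.2]
        rw [this, Real.zero_rpow hr.ne', ENNReal.ofReal_zero]
    have h3 : (m : ℝ≥0∞) * sobCap n r F U ≤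
        ENNReal.ofReal (C ^ r) * (ENNReal.ofReal (4 * (j / δ) ^ r) * volume K) := by
      calc (m : ℝ≥0∞) * sobCap n r F U = ∑ i ∈ Finset.range m, sobCap n r F U := by simp
        _ ≤ ∑ i ∈ Finset.range m, ENNReal.ofReal (C ^ r) * ∫⁻ y, ENNReal.ofReal (L i y ^ r) :=
          Finset.sum_le_sum h1
        _ = ENNReal.ofReal (C ^ r) *
            ∑ i ∈ Finset.range m, ∫⁻ y, ENNReal.ofReal (L i y ^ r) := by rw [Finset.mul_sum]
        _ ≤ ENNReal.ofReal (C ^ r) *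
            ∫⁻ y, ∑ i ∈ Finset.range m, ENNReal.ofReal (L i y ^ r) := by
          gcongr; exact sum_lintegral_le_lintegral_sum _ _
        _ ≤ ENNReal.ofReal (C ^ r) *
            ∫⁻ y, K.indicator (fun _ => ENNReal.ofReal (4 * (j / δ) ^ r)) y := by
          gcongr with y; exact h2 y
        _ = _ := by rw [lintegral_indicator_const hKc.measurableSet]
    have hKv : volume K = ENNReal.ofReal (volume.real K) :=
      (ENNReal.ofReal_toReal hKc.measure_ne_top).symm
    have hm' : (m : ℝ≥0∞) ≠ 0 := by exact_mod_cast (by omega : m ≠ 0)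
    have h4 : sobCap n r F U ≤ ENNReal.ofReal (C ^ r * (4 * (j / δ) ^ r * volume.real K)) / m := by
      rw [ENNReal.le_div_iff_mul_le (Or.inl hm') (Or.inl (ENNReal.natCast_ne_top m)), mul_comm]
      refine h3.trans_eq ?_
      rw [hKv, ← ENNReal.ofReal_mul (by positivity), ← ENNReal.ofReal_mul (by positivity)]
    refine h4.trans ?_
    rw [← ENNReal.ofReal_natCast m, ← ENNReal.ofReal_div_of_pos hm0]
    refine ENNReal.ofReal_le_ofReal ?_
    have h5 : (j / δ) ^ r ≤ (4 / δ) ^ r * (m : ℝ) ^ r := by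
      rw [← Real.mul_rpow (by positivity) hm0.le]
      refine Real.rpow_le_rpow (by positivity) ?_ hr.le
      rw [div_mul_eq_mul_div]
      gcongr
      have : (1 : ℝ) ≤ m := by exact_mod_cast hm
      simp only [hj]; linarith
    have h6 : (m : ℝ) ^ (-(1 - r)) = (m : ℝ) ^ r / m := by
      rw [neg_sub, Real.rpow_sub hm0, Real.rpow_one]
    rw [h6, hA, ← mul_div_assoc]
    gcongr ?_ / _
    calc C ^ r * (4 * (j / δ) ^ r * volume.real K)
        ≤ C ^ r * (4 * ((4 / δ) ^ r * (m : ℝ) ^ r) * volume.real K) := by gcongr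
      _ = _ := by ring
  have hlim : Tendsto (fun m : ℕ => ENNReal.ofReal (A * (m : ℝ) ^ (-(1 - r)))) atTop (𝓝 0) := by
    have h1 : Tendsto (fun m : ℕ => A * (m : ℝ) ^ (-(1 - r))) atTop (𝓝 (A * 0)) :=
      ((tendsto_rpow_neg_atTop (by linarith)).comp tendsto_natCast_atTop_atTop).const_mul A
    simpa using ENNReal.tendsto_ofReal h1
  refine le_antisymm (ge_of_tendsto hlim ?_) zero_le
  filter_upwards [eventually_ge_atTop 1] with m hm using key m hm

theorem sobCap_empty {n : ℕ} {r : ℝ} (hr : 0 < r) {U : Set (EuclideanSpace ℝ (Fin n))} :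
    sobCap n r ∅ U = 0 := by
  refine le_antisymm (sInf_le ⟨fun _ => 0, contDiff_const, HasCompactSupport.zero, ?_,
    ⟨∅, isOpen_empty, subset_rfl, by simp⟩, ?_⟩) zero_le
  · simp [tsupport]
  · simp [Real.zero_rpow hr.ne']

/-- The tent of height `H * R` which equals its maximum on the ball of radius `R` about `z` and
vanishes off the ball of radius `2 * R`. -/
def tent {X : Type*} [PseudoMetricSpace X] (H R : ℝ) (z y : X) : ℝ :=
  H * R * clip (2 - dist y z / R)

theorem abs_tent_sub_tent_le {X : Type*} [PseudoMetricSpace X] {H R δ : ℝ} {z y y₁ y₂ : X}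
    (hH : 0 ≤ H) (hR : 0 < R) (hδ : δ ≤ R) (h₁ : y₁ ∈ ball y δ) (h₂ : y₂ ∈ ball y δ) :
    |tent H R z y₁ - tent H R z y₂| ≤
      (closedBall z (3 * R)).indicator (fun _ => H) y * dist y₁ y₂ := by
  by_cases hy : y ∈ closedBall z (3 * R)
  · rw [indicator_of_mem hy]
    unfold tent
    rw [← mul_sub, abs_mul, abs_of_nonneg (by positivity)]
    calc H * R * |clip (2 - dist y₁ z / R) - clip (2 - dist y₂ z / R)|
        ≤ H * R * (dist y₁ y₂ / R) := by
          gcongr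
          refine (abs_clip_sub_clip_le _ _).trans ?_
          have : 2 - dist y₁ z / R - (2 - dist y₂ z / R) = -((dist y₁ z - dist y₂ z) / R) := by
            ring
          rw [this, abs_neg, abs_div, abs_of_pos hR]
          gcongr
          exact abs_dist_sub_le y₁ y₂ z
      _ = _ := by field_simp
  · have h0 : ∀ x ∈ ball y δ, tent H R z x = 0 := fun x hx => by
      have h1 : 3 * R < dist y z := not_le.1 hy
      have h2 := dist_triangle y x z
      have h3 : dist y x < δ := by rw [dist_comm]; exact hx
      have h4 : 2 ≤ dist x z / R := by rw [le_div_iff₀ hR]; linarith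
      rw [tent, clip_of_nonpos (by linarith), mul_zero]
    rw [h0 _ h₁, h0 _ h₂, indicator_of_notMem hy]
    simp

/-- Capacity estimate from chains of tents whose slopes grow geometrically along each chain. -/
theorem exists_sobCap_le_sum_tent (n : ℕ) {r : ℝ} (hr : 0 < r) :
    ∃ C : ℝ, 0 < C ∧ ∀ {ι κ : Type} (P : Finset ι) (X : Finset κ) (A : κ → Finset ℕ)
      (e : κ → ℕ → ι) (z : ι → EuclideanSpace ℝ (Fin n)) (H R : ι → ℝ)
      (F U K : Set (EuclideanSpace ℝ (Fin n))) (S δ ρ : ℝ),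
      IsOpen U → IsCompact K → K ⊆ U → 0 < S → 0 < δ → 0 ≤ ρ → ρ < 1 →
      (∀ x ∈ X, ∀ k ∈ A x, e x k ∈ P) →
      (∀ p ∈ P, 0 ≤ H p) → (∀ p ∈ P, δ ≤ R p) → (∀ p ∈ P, closedBall (z p) (2 * R p) ⊆ K) →
      (∀ x ∈ X, ∀ j ∈ A x, ∀ k ∈ A x, j ≤ k → H (e x j) ≤ ρ ^ (k - j) * H (e x k)) →
      (∀ y ∈ F, ∃ x ∈ X, (∀ k ∈ A x, dist y (z (e x k)) ≤ R (e x k)) ∧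
        S ≤ ∑ k ∈ A x, H (e x k) * R (e x k)) →
      sobCap n r F U ≤ ENNReal.ofReal ((C * (1 - ρ)⁻¹ / S) ^ r) *
        ∑ p ∈ P, ENNReal.ofReal (H p ^ r * R p ^ n) := by
  classical
  obtain ⟨C, hC, hcap⟩ := exists_sobCap_le n hr
  set ω : ℝ := (3 ^ n * volume.real (ball (0 : EuclideanSpace ℝ (Fin n)) 1)) with hω
  have hω0 : 0 < ω := by
    have : 0 < volume.real (ball (0 : EuclideanSpace ℝ (Fin n)) 1) :=
      ENNReal.toReal_pos (measure_ball_pos _ _ one_pos).ne' measure_ball_lt_top.ne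
    positivity
  refine ⟨C * ω ^ (1 / r), by positivity, ?_⟩
  intro ι κ P X A e z H R F U K S δ ρ hU hK hKU hS hδ hρ hρ1 he hH hR hzK hgrow hF
  have hρ' : 0 < (1 - ρ)⁻¹ := inv_pos.2 (by linarith)
  rcases X.eq_empty_or_nonempty with rfl | hX
  · have : F = ∅ := by
      refine eq_empty_of_forall_notMem fun y hy => ?_
      obtain ⟨x, hx, -⟩ := hF y hy
      simp at hx
    rw [this, sobCap_empty hr]
    exact zero_le
  have hR0 : ∀ p ∈ P, 0 < R p := fun p hp => hδ.trans_le (hR p hp)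
  set T : κ → EuclideanSpace ℝ (Fin n) → ℝ := fun x y =>
    ∑ k ∈ A x, tent (H (e x k)) (R (e x k)) (z (e x k)) y with hT
  set D : ι → EuclideanSpace ℝ (Fin n) → ℝ := fun p =>
    (closedBall (z p) (3 * R p)).indicator fun _ => H p with hD
  have hD0 : ∀ p ∈ P, ∀ y, 0 ≤ D p y := fun p hp y => indicator_nonneg (fun _ _ => hH p hp) y
  have hDH : ∀ p ∈ P, ∀ y, D p y ≤ H p := fun p hp y =>
    indicator_le_self' (fun _ _ => hH p hp) y
  set B : EuclideanSpace ℝ (Fin n) → ℝ := fun y => (∑ p ∈ P, D p y ^ r) ^ (1 / r) with hB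
  have hsum0 : ∀ y, 0 ≤ ∑ p ∈ P, D p y ^ r := fun y =>
    Finset.sum_nonneg fun p hp => Real.rpow_nonneg (hD0 p hp y) r
  have hB0 : ∀ y, 0 ≤ B y := fun y => Real.rpow_nonneg (hsum0 y) _
  have hDB : ∀ p ∈ P, ∀ y, D p y ≤ B y := fun p hp y => by
    have h1 : D p y ^ r ≤ ∑ p ∈ P, D p y ^ r :=
      Finset.single_le_sum (f := fun p => D p y ^ r)
        (fun p hp => Real.rpow_nonneg (hD0 p hp y) r) hp
    calc D p y = (D p y ^ r) ^ (1 / r) := by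
          rw [← Real.rpow_mul (hD0 p hp y), mul_one_div_cancel hr.ne', Real.rpow_one]
      _ ≤ B y := Real.rpow_le_rpow (Real.rpow_nonneg (hD0 p hp y) r) h1 (by positivity)
  have hBM : ∀ y, B y ≤ (∑ p ∈ P, H p ^ r) ^ (1 / r) := fun y =>
    Real.rpow_le_rpow (hsum0 y) (Finset.sum_le_sum fun p hp =>
      Real.rpow_le_rpow (hD0 p hp y) (hDH p hp y) hr.le) (by positivity)
  have hTL : ∀ x ∈ X, ∀ y, ∀ y₁ ∈ ball y δ, ∀ y₂ ∈ ball y δ,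
      |T x y₁ - T x y₂| ≤ (1 - ρ)⁻¹ * B y * dist y₁ y₂ := by
    intro x hx y y₁ h₁ y₂ h₂
    have h1 : |T x y₁ - T x y₂| ≤ ∑ k ∈ A x, D (e x k) y * dist y₁ y₂ := by
      simp only [hT]
      rw [← Finset.sum_sub_distrib]
      refine (Finset.abs_sum_le_sum_abs _ _).trans (Finset.sum_le_sum fun k hk => ?_)
      have hp := he x hx k hk
      exact abs_tent_sub_tent_le (hH _ hp) (hR0 _ hp) (hR _ hp) h₁ h₂
    refine h1.trans ?_
    rw [← Finset.sum_mul]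
    refine mul_le_mul_of_nonneg_right ?_ dist_nonneg
    have h2 : ∑ k ∈ A x, D (e x k) y =
        ∑ k ∈ (A x).filter (fun k => y ∈ closedBall (z (e x k)) (3 * R (e x k))),
          H (e x k) := by
      rw [Finset.sum_filter]
      refine Finset.sum_congr rfl fun k _ => ?_
      simp only [hD, indicator_apply]
    rw [h2]
    refine sum_le_of_geometric_growth hρ hρ1 (hB0 y) (fun j hj k hk hjk => ?_) (fun k hk => ?_)
    · exact hgrow x hx j (Finset.mem_filter.1 hj).1 k (Finset.mem_filter.1 hk).1 hjk
    · obtain ⟨hk1, hk2⟩ := Finset.mem_filter.1 hk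
      have := hDB _ (he x hx k hk1) y
      simpa only [hD, indicator_of_mem hk2] using this
  set w : EuclideanSpace ℝ (Fin n) → ℝ := fun y => X.sup' hX fun x => T x y with hw
  have hwsub : ∀ y, ∀ y₁ ∈ ball y δ, ∀ y₂ ∈ ball y δ,
      w y₁ - w y₂ ≤ (1 - ρ)⁻¹ * B y * dist y₁ y₂ := by
    intro y y₁ h₁ y₂ h₂
    obtain ⟨x, hx, hxe⟩ := Finset.exists_mem_eq_sup' hX fun x => T x y₁
    have h1 : T x y₂ ≤ w y₂ := Finset.le_sup' (fun x => T x y₂) hx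
    have h2 := (abs_le.1 (hTL x hx y y₁ h₁ y₂ h₂)).2
    have h3 : w y₁ = T x y₁ := hxe
    linarith
  have hcap' := hcap F U K w (fun y => (1 - ρ)⁻¹ * B y) S δ
    ((1 - ρ)⁻¹ * (∑ p ∈ P, H p ^ r) ^ (1 / r)) hU hK hKU hS hδ (fun y hy => ?_) (fun y hy => ?_)
    (fun y => mul_nonneg hρ'.le (hB0 y)) (fun y => by have := hBM y; gcongr)
    (fun y y₁ h₁ y₂ h₂ => ?_)
  · refine hcap'.trans ?_
    have hint : ∫⁻ y, ENNReal.ofReal (((1 - ρ)⁻¹ * B y) ^ r) =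
        ENNReal.ofReal ((1 - ρ)⁻¹ ^ r) *
          (ENNReal.ofReal ω * ∑ p ∈ P, ENNReal.ofReal (H p ^ r * R p ^ n)) := by
      have h1 : ∀ y, ENNReal.ofReal (((1 - ρ)⁻¹ * B y) ^ r) = ENNReal.ofReal ((1 - ρ)⁻¹ ^ r) *
          ∑ p ∈ P, (closedBall (z p) (3 * R p)).indicator
            (fun _ => ENNReal.ofReal (H p ^ r)) y := by
        intro y
        rw [Real.mul_rpow hρ'.le (hB0 y), ENNReal.ofReal_mul (by positivity)]
        congr 1
        simp only [hB]
        rw [← Real.rpow_mul (hsum0 y), one_div_mul_cancel hr.ne', Real.rpow_one,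
          ENNReal.ofReal_sum_of_nonneg fun p hp => Real.rpow_nonneg (hD0 p hp y) r]
        refine Finset.sum_congr rfl fun p _ => ?_
        simp only [hD, indicator_apply]
        split_ifs
        · rfl
        · rw [Real.zero_rpow hr.ne', ENNReal.ofReal_zero]
      simp_rw [h1]
      rw [lintegral_const_mul' _ _ ENNReal.ofReal_ne_top, lintegral_finsetSum]
      · congr 1
        rw [Finset.mul_sum]
        refine Finset.sum_congr rfl fun p hp => ?_
        have hRp := hR0 p hp
        have hHp := hH p hp
        rw [lintegral_indicator_const isClosed_closedBall.measurableSet,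
          Measure.addHaar_closedBall _ _ (by positivity), finrank_euclideanSpace_fin,
          ← ENNReal.ofReal_toReal (measure_ball_lt_top (μ := volume)
            (x := (0 : EuclideanSpace ℝ (Fin n))) (r := 1)).ne,
          ← ENNReal.ofReal_mul (by positivity), ← ENNReal.ofReal_mul (by positivity),
          ← ENNReal.ofReal_mul (by positivity)]
        congr 1
        simp only [hω, Measure.real]
        ring
      · exact fun p _ => measurable_const.indicator isClosed_closedBall.measurableSet
    rw [hint, ← mul_assoc, ← mul_assoc, ← ENNReal.ofReal_mul (by positivity),
      ← ENNReal.ofReal_mul (by positivity)]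
    gcongr
    rw [← Real.mul_rpow (by positivity) hρ'.le]
    have h2 : (ω ^ (1 / r)) ^ r = ω := by
      rw [← Real.rpow_mul hω0.le, one_div_mul_cancel hr.ne', Real.rpow_one]
    nth_rewrite 1 [← h2]
    rw [← Real.mul_rpow (by positivity) (by positivity)]
    apply le_of_eq
    congr 1
    ring
  · obtain ⟨x, hx, hk, hSx⟩ := hF y hy
    refine hSx.trans ((Finset.sum_le_sum fun k hkA => ?_).trans
      (Finset.le_sup' (fun x => T x y) hx))
    have hp := he x hx k hkA
    have h1 : dist y (z (e x k)) / R (e x k) ≤ 1 := (div_le_one (hR0 _ hp)).2 (hk k hkA)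
    rw [tent, clip_of_one_le (by linarith), mul_one]
  · obtain ⟨x, hx, hxe⟩ := Finset.exists_mem_eq_sup' hX fun x => T x y
    have : w y = T x y := hxe
    rw [this]
    refine Finset.sum_eq_zero fun k hk => ?_
    have hp := he x hx k hk
    have h1 : 2 * R (e x k) < dist y (z (e x k)) := not_le.1 fun h => hy (hzK _ hp h)
    have h2 : 2 < dist y (z (e x k)) / R (e x k) := (lt_div_iff₀ (hR0 _ hp)).2 h1
    rw [tent, clip_of_nonpos (by linarith), mul_zero]
  · refine abs_le.2 ⟨?_, hwsub y y₁ h₁ y₂ h₂⟩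
    have := hwsub y y₂ h₂ y₁ h₁
    rw [dist_comm] at this
    linarith

/-- Capacity estimate for images: if along every point of `E₀` the weights of the dyadic cells
add up to at least `S`, then the capacity of the image of `E₀` is controlled by `S` and the
integral of `G ^ σ`. -/
theorem exists_sobCap_image_le {n : ℕ} {r a q σ : ℝ} (hn : 0 < n) (hr : 0 < r) (ha : 0 < a)
    (haq : a < q) (hq : n < q) (hσ : 1 < σ) (hσe : r / a + (n - r) / q = σ) :
    ∃ C : ℝ, 0 < C ∧ ∀ (V U K E₀ : Set (EuclideanSpace ℝ (Fin n)))
      (f : EuclideanSpace ℝ (Fin n) → EuclideanSpace ℝ (Fin n))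
      (Df : EuclideanSpace ℝ (Fin n) → EuclideanSpace ℝ (Fin n) →L[ℝ] EuclideanSpace ℝ (Fin n))
      (G : EuclideanSpace ℝ (Fin n) → ℝ) (k₀ N : ℕ) (S δ : ℝ),
      IsOpen V → ContinuousOn f V → HasWeakDerivOn f Df V → IntegrableOn G V →
      (∀ y, 1 ≤ G y) → (∀ y ∈ V, ‖Df y‖ ≤ G y ^ (1 / q)) → IsOpen U → IsCompact K → K ⊆ U →
      Bornology.IsBounded E₀ → (∀ x ∈ E₀, closedBall x (2 * (n * (2 ^ k₀)⁻¹)) ⊆ V) →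
      (∀ x ∈ E₀, closedBall (f x) δ ⊆ K) →
      (∀ x ∈ E₀, ∀ k ≥ k₀, 3 * (morreyConst n q * (2 ^ k)⁻¹ * cellAvg k x G ^ (1 / q)) ≤ δ) →
      0 < S → (∀ x ∈ E₀, S ≤ ∑ k ∈ Finset.Ico k₀ N, cellWeight G a x k) →
      sobCap n r (f '' E₀) U ≤
        ENNReal.ofReal (C / S ^ r) * ∫⁻ y in V, ENNReal.ofReal (G y ^ σ) := by
  classical
  obtain ⟨C, hC, hcap⟩ := exists_sobCap_le_sum_tent n hr
  set m := morreyConst n q with hm_def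
  have hm : 0 < m := morreyConst_pos hn hq
  have hq0 : 0 < q := ha.trans haq
  set g : ℝ := 1 / a - 1 / q with hg_def
  have hg : 0 < g := sub_pos.2 (one_div_lt_one_div_of_lt ha haq)
  set ρ : ℝ := (2 / 3) ^ (a * g) with hρ_def
  have hρ0 : 0 < ρ := by positivity
  have hρ1 : ρ < 1 := Real.rpow_lt_one (by norm_num) (by norm_num) (by positivity)
  have hρ' : 0 < (1 - ρ)⁻¹ := inv_pos.2 (by linarith)
  set B : ℝ := 2 ^ σ * (1 - (2 / 3) ^ (a * (σ - 1)))⁻¹ with hB_def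
  have hB : 0 < B := by
    have : ((2 : ℝ) / 3) ^ (a * (σ - 1)) < 1 :=
      Real.rpow_lt_one (by norm_num) (by norm_num) (mul_pos ha (by linarith))
    have : 0 < (1 - ((2 : ℝ) / 3) ^ (a * (σ - 1)))⁻¹ := inv_pos.2 (by linarith)
    positivity
  refine ⟨(C * (1 - ρ)⁻¹ * 4) ^ r * (m⁻¹ ^ r * m ^ n) * B, by positivity, ?_⟩
  intro V U K E₀ f Df G k₀ N S δ hV hf hDf hG hG1 hDG hU hK hKU hE₀ hE₀V hE₀K hsmall hS hsum
  have hG0 : ∀ y, 0 ≤ G y := fun y => zero_le_one.trans (hG1 y)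
  have hball : ∀ x ∈ E₀, ∀ k ≥ k₀, closedBall x (2 * (n * (2 ^ k)⁻¹)) ⊆ V := fun x hx k hk =>
    (closedBall_subset_closedBall (by gcongr; norm_num)).trans (hE₀V x hx)
  have hcell : ∀ x ∈ E₀, ∀ k ≥ k₀, dyadicCell k x ⊆ V := fun x hx k hk =>
    dyadicCell_subset_closedBall.trans ((closedBall_subset_closedBall (by
      have : (0 : ℝ) ≤ n * (2 ^ k)⁻¹ := by positivity
      linarith)).trans (hball x hx k hk))
  obtain ⟨X₀, hX₀E, hX₀fin, hX₀⟩ := exists_subset_image_finite_and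
    (p := fun t : Set (EuclideanSpace ℝ (Fin n)) => t = dyadicCorner N '' E₀).1
    ⟨_, subset_rfl, finite_image_dyadicCorner hE₀ N, rfl⟩
  set X : Finset (EuclideanSpace ℝ (Fin n)) := hX₀fin.toFinset with hX_def
  have hXE : ∀ x ∈ X, x ∈ E₀ := fun x hx => hX₀E (hX₀fin.mem_toFinset.1 hx)
  set A : EuclideanSpace ℝ (Fin n) → Finset ℕ := fun x =>
    (Finset.Ico k₀ N).filter (IsGoodIndex (3 / 4) k₀ (cellWeight G a x)) with hA
  set e : EuclideanSpace ℝ (Fin n) → ℕ → ℕ × EuclideanSpace ℝ (Fin n) := fun x k =>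
    (k, dyadicCorner k x) with he
  set P : Finset (ℕ × EuclideanSpace ℝ (Fin n)) := X.biUnion fun x => (A x).image (e x) with hP
  have hAk : ∀ x, ∀ k ∈ A x, k₀ ≤ k ∧ k < N ∧ IsGoodCell G a k₀ k x := fun x k hk => by
    obtain ⟨h1, h2⟩ := Finset.mem_filter.1 hk
    exact ⟨(Finset.mem_Ico.1 h1).1, (Finset.mem_Ico.1 h1).2, h2⟩
  have hPe : ∀ p ∈ P, ∃ x ∈ E₀, ∃ k, k₀ ≤ k ∧ k < N ∧ IsGoodCell G a k₀ k x ∧ e x k = p := by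
    intro p hp
    obtain ⟨x, hx, hp⟩ := Finset.mem_biUnion.1 hp
    obtain ⟨k, hk, rfl⟩ := Finset.mem_image.1 hp
    obtain ⟨h1, h2, h3⟩ := hAk x k hk
    exact ⟨x, hXE x hx, k, h1, h2, h3, rfl⟩
  set b : ℕ × EuclideanSpace ℝ (Fin n) → ℝ := fun p => cellAvg p.1 p.2 G with hb_def
  have hbe : ∀ x k, b (e x k) = cellAvg k x G := fun x k => cellAvg_eq_of_mem G dyadicCorner_mem
  have hb1' : ∀ x ∈ E₀, ∀ k ≥ k₀, 1 ≤ cellAvg k x G := fun x hx k hk =>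
    one_le_cellAvg (hG.mono_set (hcell x hx k hk)) hG1
  have hb1 : ∀ p ∈ P, 1 ≤ b p := by
    intro p hp
    obtain ⟨x, hx, k, hk, -, -, rfl⟩ := hPe p hp
    rw [hbe]
    exact hb1' x hx k hk
  set R : ℕ × EuclideanSpace ℝ (Fin n) → ℝ := fun p => m * (2 ^ p.1)⁻¹ * b p ^ (1 / q) with hR
  set H : ℕ × EuclideanSpace ℝ (Fin n) → ℝ := fun p => b p ^ g * m⁻¹ with hH
  have hHR : ∀ p ∈ P, H p * R p = (2 ^ p.1)⁻¹ * b p ^ (1 / a) := by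
    intro p hp
    have hb0 : 0 < b p := zero_lt_one.trans_le (hb1 p hp)
    have : b p ^ (1 / a) = b p ^ g * b p ^ (1 / q) := by
      rw [← Real.rpow_add hb0, hg_def, sub_add_cancel]
    simp only [hH, hR, this]
    field_simp
  have hHRe : ∀ x ∈ X, ∀ k ∈ A x, H (e x k) * R (e x k) = cellWeight G a x k := by
    intro x hx k hk
    rw [hHR _ (Finset.mem_biUnion.2 ⟨x, hx, Finset.mem_image_of_mem _ hk⟩), hbe]
    rfl
  have hdist : ∀ x ∈ E₀, ∀ k ≥ k₀, ∀ y ∈ dyadicCell k x, ∀ y' ∈ dyadicCell k x,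
      dist (f y) (f y') ≤ R (e x k) := by
    intro x hx k hk y hy y' hy'
    simp only [hR, hbe]
    exact dist_le_of_mem_dyadicCell_of_hasWeakDerivOn hDf hf hV hn hq hG hG0 hDG
      (hball x hx k hk) hy hy'
  have key := hcap P X A e (fun p => f p.2) H R (f '' E₀) U K (S / 4) (m * (2 ^ N)⁻¹) ρ hU hK hKU
    (by positivity) (by positivity) hρ0.le hρ1 ?_ ?_ ?_ ?_ ?_ ?_
  · refine key.trans ?_
    have hterm : ∀ p ∈ P, ENNReal.ofReal (H p ^ r * R p ^ n) =
        ENNReal.ofReal (m⁻¹ ^ r * m ^ n) * ENNReal.ofReal (((2 ^ p.1)⁻¹) ^ n * b p ^ σ) := by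
      intro p hp
      have hb0 : 0 < b p := zero_lt_one.trans_le (hb1 p hp)
      rw [← ENNReal.ofReal_mul (by positivity)]
      congr 1
      have h1 : b p ^ σ = (b p ^ g) ^ r * (b p ^ (1 / q)) ^ n := by
        rw [← Real.rpow_mul hb0.le, ← Real.rpow_natCast, ← Real.rpow_mul hb0.le,
          ← Real.rpow_add hb0, ← hσe, hg_def]
        congr 1
        field_simp
        ring
      simp only [hH, hR, h1]
      rw [Real.mul_rpow (by positivity) (by positivity)]
      ring
    rw [Finset.sum_congr rfl hterm, ← Finset.mul_sum]
    have hgood := sum_goodCell_le (k₀ := k₀) hG hG1 ha hσ (P := P) (fun p hp => by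
      obtain ⟨x, hx, k, hk, hkN, hgk, rfl⟩ := hPe p hp
      refine ⟨dyadicCorner_dyadicCorner, hk, ?_, (isGoodCell_iff_of_mem dyadicCorner_mem).2 hgk⟩
      simp only [he]
      rw [dyadicCell_dyadicCorner]
      exact hcell x hx k hk)
    calc ENNReal.ofReal ((C * (1 - ρ)⁻¹ / (S / 4)) ^ r) * (ENNReal.ofReal (m⁻¹ ^ r * m ^ n) *
          ∑ p ∈ P, ENNReal.ofReal (((2 ^ p.1)⁻¹) ^ n * b p ^ σ))
        ≤ ENNReal.ofReal ((C * (1 - ρ)⁻¹ / (S / 4)) ^ r) * (ENNReal.ofReal (m⁻¹ ^ r * m ^ n) *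
          (ENNReal.ofReal B * ∫⁻ y in V, ENNReal.ofReal (G y ^ σ))) := by gcongr
      _ = _ := by
        rw [← mul_assoc, ← mul_assoc, ← ENNReal.ofReal_mul (by positivity),
          ← ENNReal.ofReal_mul (by positivity)]
        congr 2
        have h1 : C * (1 - ρ)⁻¹ / (S / 4) = C * (1 - ρ)⁻¹ * 4 / S := by field_simp
        rw [h1, Real.div_rpow (by positivity) hS.le]
        ring
  · exact fun x hx k hk => Finset.mem_biUnion.2 ⟨x, hx, Finset.mem_image_of_mem _ hk⟩
  · intro p hp
    have := hb1 p hp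
    positivity
  · intro p hp
    have h1 : 1 ≤ b p ^ (1 / q) := Real.one_le_rpow (hb1 p hp) (by positivity)
    obtain ⟨x, hx, k, hk, hkN, -, rfl⟩ := hPe p hp
    have h2 : ((2 : ℝ) ^ N)⁻¹ ≤ (2 ^ k)⁻¹ := by gcongr; norm_num
    calc m * (2 ^ N)⁻¹ ≤ m * (2 ^ k)⁻¹ * 1 := by rw [mul_one]; gcongr
      _ ≤ _ := by simp only [hR]; gcongr
  · intro p hp
    have := hb1 p hp
    obtain ⟨x, hx, k, hk, hkN, -, rfl⟩ := hPe p hp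
    refine (closedBall_subset_closedBall' ?_).trans (hE₀K x hx)
    have h1 := hdist x hx k hk (dyadicCorner k x) dyadicCorner_mem x mem_dyadicCell_self
    have h2 : 3 * R (e x k) ≤ δ := by
      simp only [hR, hbe]
      exact hsmall x hx k hk
    show 2 * R (e x k) + dist (f (dyadicCorner k x)) (f x) ≤ δ
    linarith
  · intro x hx j hj k hk hjk
    obtain ⟨hk1, -, hk3⟩ := hAk x k hk
    have h1 := hk3.cellAvg_rpow_le ha hG0 (hAk x j hj).1 hjk hg.le
    simp only [hH, hbe]
    rw [← mul_assoc]
    gcongr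
  · rintro _ ⟨x, hx, rfl⟩
    obtain ⟨x', hx', hxx'⟩ : dyadicCorner N x ∈ dyadicCorner N '' X₀ := by
      rw [hX₀]; exact mem_image_of_mem _ hx
    have hx'X : x' ∈ X := hX₀fin.mem_toFinset.2 hx'
    have hxN : x ∈ dyadicCell N x' := by
      rw [← dyadicCell_dyadicCorner, hxx', dyadicCell_dyadicCorner]
      exact mem_dyadicCell_self
    refine ⟨x', hx'X, fun k hk => ?_, ?_⟩
    · obtain ⟨hk1, hk2, -⟩ := hAk x' k hk
      exact hdist x' (hXE _ hx'X) k hk1 x (dyadicCell_anti hk2.le hxN) _ dyadicCorner_mem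
    · rw [Finset.sum_congr rfl (hHRe x' hx'X)]
      have h1 := sum_le_sum_isGoodIndex (c := cellWeight G a x') (lam := 3 / 4) (k₀ := k₀)
        (by norm_num) (by norm_num) (fun k => ?_) N
      · have h2 := hsum x' (hXE _ hx'X)
        have h3 : (1 - 3 / 4 : ℝ)⁻¹ = 4 := by norm_num
        rw [h3] at h1
        have h4 : S ≤ 4 * ∑ k ∈ A x', cellWeight G a x' k := by
          refine h2.trans (h1.trans_eq ?_)
          simp only [hA]
        linarith
      · have h5 : 0 ≤ cellAvg k x' G := by
          rw [cellAvg, smul_eq_mul]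
          exact mul_nonneg (by positivity) (integral_nonneg hG0)
        unfold cellWeight
        positivity

/-- A Poincaré inequality in `L¹` for functions supported in a fixed bounded set. -/
theorem exists_lintegral_enorm_le_lintegral_fderiv {n : ℕ} (hn : 2 ≤ n)
    {V : Set (EuclideanSpace ℝ (Fin n))} (hV : Bornology.IsBounded V) :
    ∃ C : ℝ≥0, ∀ u : EuclideanSpace ℝ (Fin n) → ℝ, ContDiff ℝ 1 u → Function.support u ⊆ V →
      ∫⁻ x, ‖u x‖ₑ ≤ C * ∫⁻ x, ‖fderiv ℝ u x‖ₑ := by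
  refine ⟨eLpNormLESNormFDerivOfLeConst ℝ volume V 1 1, fun u hu hs => ?_⟩
  have := eLpNorm_le_eLpNorm_fderiv volume hu hs (p := 1) le_rfl (by
    rw [finrank_euclideanSpace_fin]; exact_mod_cast hn) hV
  rw [ENNReal.coe_one, eLpNorm_one_eq_lintegral_enorm, eLpNorm_one_eq_lintegral_enorm] at this
  exact this

theorem tendsto_inv_two_pow : Tendsto (fun k : ℕ => ((2 : ℝ) ^ k)⁻¹) atTop (𝓝 0) := by
  simp_rw [← inv_pow]
  exact tendsto_pow_atTop_nhds_zero_of_lt_one (by norm_num) (by norm_num)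

/-- If `u` equals `1` near the compact set `E₀`, has small averages at scale `k₀`, and has gradient
at most `τ * G ^ (1 / a)`, then the weights along each point of `E₀` add up to at least a
multiple of `τ⁻¹`. -/
theorem exists_le_sum_cellWeight {n : ℕ} (hn : 0 < n) {a τ : ℝ} (ha : 1 ≤ a) (hτ : 0 < τ)
    {E₀ V₁ : Set (EuclideanSpace ℝ (Fin n))} {u G : EuclideanSpace ℝ (Fin n) → ℝ} (k₀ : ℕ)
    (hE₀ : IsCompact E₀) (hV₁ : IsOpen V₁) (hEV : E₀ ⊆ V₁) (hu : ContDiff ℝ 1 u)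
    (hu1 : ∀ y ∈ V₁, u y = 1) (hG0 : ∀ y, 0 ≤ G y)
    (hG : ∀ x ∈ E₀, IntegrableOn G (dyadicCell k₀ x))
    (hGu : ∀ y, ‖fderiv ℝ u y‖ ≤ τ * G y ^ (1 / a))
    (hk₀ : ∀ x ∈ E₀, |cellAvg k₀ x u| ≤ 1 / 2) :
    ∃ N, ∀ x ∈ E₀, 1 / (2 * (2 ^ n * n)) / τ ≤ ∑ k ∈ Finset.Ico k₀ N, cellWeight G a x k := by
  obtain ⟨δ, hδ, hEδ⟩ := hE₀.exists_cthickening_subset_open hV₁ hEV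
  have hlim : Tendsto (fun k : ℕ => (n : ℝ) * (2 ^ k)⁻¹) atTop (𝓝 0) := by
    simpa using tendsto_inv_two_pow.const_mul (n : ℝ)
  obtain ⟨N, hN, hkN⟩ := ((hlim.eventually_le_const hδ).and (eventually_ge_atTop k₀)).exists
  refine ⟨N, fun x hx => ?_⟩
  have hn0 : (0 : ℝ) < n := by exact_mod_cast hn
  have h1 : cellAvg N x u = 1 := cellAvg_const_of_forall fun y hy => hu1 y <| hEδ <|
    closedBall_subset_cthickening hx δ <| closedBall_subset_closedBall hN <|
    dyadicCell_subset_closedBall hy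
  have h2 : dist (cellAvg k₀ x u) (cellAvg N x u) ≤
      ∑ k ∈ Finset.Ico k₀ N, 2 ^ n * n * τ * cellWeight G a x k := by
    refine (dist_le_Ico_sum_dist (fun k => cellAvg k x u) hkN).trans
      (Finset.sum_le_sum fun k hk => ?_)
    rw [dist_comm, dist_eq_norm]
    refine (norm_cellAvg_succ_sub_le ha hτ.le (enorm_cellAvg_succ_sub_le hu k x)
      ((hG x hx).mono_set (dyadicCell_anti (Finset.mem_Ico.1 hk).1)) hG0 (fun y _ => ?_)).trans_eq
      ?_
    · rw [← ofReal_norm]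
      exact ENNReal.ofReal_le_ofReal (hGu y)
    · rw [cellWeight]; ring
  rw [h1, ← Finset.mul_sum, Real.dist_eq] at h2
  have h3 := (abs_le.1 (hk₀ x hx)).2
  have h4 : 1 / 2 ≤ 2 ^ n * n * τ * ∑ k ∈ Finset.Ico k₀ N, cellWeight G a x k := by
    refine le_trans ?_ h2
    rw [abs_sub_comm]
    refine le_trans ?_ (le_abs_self _)
    linarith
  rw [div_div, div_le_iff₀ (by positivity)]
  linarith

theorem rpow_add_one_add_le {x y σ : ℝ} (hx : 0 ≤ x) (hy : 0 ≤ y) (hσ : 0 ≤ σ) :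
    (x + 1 + y) ^ σ ≤ 3 ^ σ * (x ^ σ + 1 + y ^ σ) := by
  have hxσ := Real.rpow_nonneg hx σ
  have hyσ := Real.rpow_nonneg hy σ
  set m := max (max x 1) y with hm
  have hm0 : 0 ≤ m := hy.trans (le_max_right _ _)
  have h1 : x + 1 + y ≤ 3 * m := by
    have h1 : x ≤ m := (le_max_left _ _).trans (le_max_left _ _)
    have h2 : 1 ≤ m := (le_max_right _ _).trans (le_max_left _ _)
    have h3 : y ≤ m := le_max_right _ _
    linarith
  refine (Real.rpow_le_rpow (by positivity) h1 hσ).trans ?_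
  rw [Real.mul_rpow (by norm_num) hm0]
  gcongr
  rcases max_choice (max x 1) y with h | h
  · rcases max_choice x 1 with h' | h'
    · rw [hm, h, h']; linarith
    · rw [hm, h, h', Real.one_rpow]; linarith
  · rw [hm, h]; linarith

theorem le_one_add_rpow {t s : ℝ} (ht : 0 ≤ t) (hs : 1 ≤ s) : t ≤ 1 + t ^ s := by
  rcases le_total t 1 with h | h
  · have := Real.rpow_nonneg ht s
    linarith
  · have := Real.rpow_le_rpow_of_exponent_le h hs
    rw [Real.rpow_one] at this
    linarith

theorem rpow_le_one_add_rpow {t s p : ℝ} (ht : 0 ≤ t) (hs : 0 ≤ s) (hsp : s ≤ p) :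
    t ^ s ≤ 1 + t ^ p := by
  rcases le_total t 1 with h | h
  · have h1 := Real.rpow_le_one ht h hs
    have := Real.rpow_nonneg ht p
    linarith
  · have := Real.rpow_le_rpow_of_exponent_le h hsp
    linarith

/-- The weight built from the gradient of a test function and the weak derivative of the map. -/
theorem lintegral_weight_rpow_le {n : ℕ} {a q σ s p τ : ℝ} (hσ : 0 ≤ σ) (hq : 0 ≤ q)
    (hτ : 0 < τ) (haσ : a * σ = s) (hqσ : q * σ ≤ p) {V : Set (EuclideanSpace ℝ (Fin n))}
    {A B : EuclideanSpace ℝ (Fin n) → ℝ} (hA0 : ∀ y, 0 ≤ A y) (hB0 : ∀ y, 0 ≤ B y)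
    (hA : Measurable A)
    (hAτ : ∫⁻ y in V, ENNReal.ofReal (A y ^ s) ≤ ENNReal.ofReal (τ ^ s)) :
    ∫⁻ y in V, ENNReal.ofReal (((A y / τ) ^ a + 1 + B y ^ q) ^ σ) ≤
      ENNReal.ofReal (3 ^ σ) *
        (1 + 2 * volume V + ∫⁻ y in V, ENNReal.ofReal (B y ^ p)) := by
  have hpt : ∀ y, ENNReal.ofReal (((A y / τ) ^ a + 1 + B y ^ q) ^ σ) ≤
      ENNReal.ofReal (3 ^ σ) * ((ENNReal.ofReal ((τ ^ s)⁻¹) * ENNReal.ofReal (A y ^ s) + 2) +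
        ENNReal.ofReal (B y ^ p)) := by
    intro y
    have h1 := hA0 y
    have h2 := hB0 y
    have h3 : 0 ≤ A y ^ s := Real.rpow_nonneg h1 s
    have h4 : 0 ≤ B y ^ p := Real.rpow_nonneg h2 p
    have h2' : (2 : ℝ≥0∞) = ENNReal.ofReal 2 := by simp
    rw [h2', ← ENNReal.ofReal_mul (by positivity), ← ENNReal.ofReal_add (by positivity) (by simp),
      ← ENNReal.ofReal_add (by positivity) h4, ← ENNReal.ofReal_mul (by positivity)]
    refine ENNReal.ofReal_le_ofReal ?_
    refine (rpow_add_one_add_le (by positivity) (Real.rpow_nonneg h2 q) hσ).trans ?_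
    rw [← Real.rpow_mul (by positivity), ← Real.rpow_mul h2, haσ, Real.div_rpow h1 hτ.le]
    refine mul_le_mul_of_nonneg_left ?_ (by positivity)
    have h5 := rpow_le_one_add_rpow h2 (mul_nonneg hq hσ) hqσ
    rw [div_eq_inv_mul]
    linarith
  refine (lintegral_mono hpt).trans ?_
  have hm : Measurable fun y => ENNReal.ofReal ((τ ^ s)⁻¹) * ENNReal.ofReal (A y ^ s) :=
    measurable_const.mul (hA.pow_const s).ennreal_ofReal
  have hm2 : Measurable fun y => ENNReal.ofReal ((τ ^ s)⁻¹) * ENNReal.ofReal (A y ^ s) + 2 :=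
    hm.add measurable_const
  rw [lintegral_const_mul' _ _ ENNReal.ofReal_ne_top, lintegral_add_left hm2,
    lintegral_add_left hm, lintegral_const_mul' _ _ ENNReal.ofReal_ne_top, setLIntegral_const]
  gcongr
  calc ENNReal.ofReal ((τ ^ s)⁻¹) * ∫⁻ y in V, ENNReal.ofReal (A y ^ s)
      ≤ ENNReal.ofReal ((τ ^ s)⁻¹) * ENNReal.ofReal (τ ^ s) := by gcongr
    _ = 1 := by
      rw [← ENNReal.ofReal_mul (by positivity), inv_mul_cancel₀ (by positivity),
        ENNReal.ofReal_one]

theorem eventually_three_mul_morreyConst_le {n : ℕ} {q m M δ : ℝ} (hq : n < q) (hq0 : 0 < q)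
    (hM : 0 ≤ M) (hδ : 0 < δ) : ∀ᶠ k : ℕ in atTop,
      3 * (m * (2 ^ k)⁻¹ * ((2 ^ k) ^ n * M) ^ (1 / q)) ≤ δ := by
  have h1 : ∀ k : ℕ, 3 * (m * ((2 : ℝ) ^ k)⁻¹ * ((2 ^ k) ^ n * M) ^ (1 / q)) =
      3 * m * M ^ (1 / q) * ((2 : ℝ) ^ (n / q - 1)) ^ k := by
    intro k
    rw [Real.mul_rpow (by positivity) hM, ← Real.rpow_natCast ((2 : ℝ) ^ k),
      ← Real.rpow_mul (by positivity), ← Real.rpow_natCast 2 k, ← Real.rpow_mul (by norm_num),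
      ← Real.rpow_natCast, ← Real.rpow_mul (by norm_num), sub_mul, Real.rpow_sub (by norm_num)]
    have : (k : ℝ) * (n * (1 / q)) = n / q * k := by ring
    rw [this, one_mul]
    ring
  have h2 : (2 : ℝ) ^ (n / q - 1) < 1 :=
    Real.rpow_lt_one_of_one_lt_of_neg (by norm_num) (by
      rw [sub_neg, div_lt_one hq0]; exact hq)
  have h3 := (tendsto_pow_atTop_nhds_zero_of_lt_one (by positivity) h2).const_mul
    (3 * m * M ^ (1 / q))
  rw [mul_zero] at h3
  simp_rw [h1]
  exact h3.eventually_le_const hδ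

theorem exists_lintegral_fderiv_lt_of_sobCap_eq_zero {n : ℕ} {s : ℝ}
    {E V : Set (EuclideanSpace ℝ (Fin n))} (h : sobCap n s E V = 0) {η : ℝ≥0∞} (hη : 0 < η) :
    ∃ u : EuclideanSpace ℝ (Fin n) → ℝ, ContDiff ℝ (⊤ : ℕ∞) u ∧ tsupport u ⊆ V ∧
      (∃ W, IsOpen W ∧ E ⊆ W ∧ ∀ x ∈ W, u x = 1) ∧
      ∫⁻ x in V, ENNReal.ofReal (‖fderiv ℝ u x‖ ^ s) < η := by
  rw [sobCap] at h
  rw [← h] at hη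
  obtain ⟨_, ⟨u, hu, -, huV, hW, rfl⟩, hlt⟩ := sInf_lt_iff.1 hη
  exact ⟨u, hu, huV, hW, hlt⟩

theorem abs_cellAvg_le {n k : ℕ} {x : EuclideanSpace ℝ (Fin n)}
    {u : EuclideanSpace ℝ (Fin n) → ℝ} {B : ℝ} (hB : 0 ≤ B)
    (h : ∫⁻ y, ‖u y‖ₑ ≤ ENNReal.ofReal B) : |cellAvg k x u| ≤ (2 ^ k) ^ n * B := by
  rw [cellAvg, smul_eq_mul, abs_mul, abs_of_nonneg (by positivity)]
  gcongr
  rw [← Real.norm_eq_abs]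
  refine (norm_integral_le_lintegral_norm u).trans ?_
  refine ENNReal.toReal_le_of_le_ofReal hB (le_trans ?_ h)
  simp_rw [ofReal_norm]
  exact setLIntegral_le_lintegral _ _

/-- The image of a set of zero capacity under a Sobolev map has zero capacity, in terms of
auxiliary exponents. -/
theorem sobCap_image_eq_zero {n : ℕ} (hn : 2 ≤ n) {r a q σ s p : ℝ} (hr : 0 < r) (ha : 1 ≤ a)
    (haq : a < q) (hq : n < q) (hσ : 1 < σ) (hσe : r / a + (n - r) / q = σ) (haσ : a * σ = s)
    (hqσ : q * σ ≤ p) {V U K E₀ : Set (EuclideanSpace ℝ (Fin n))}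
    {f : EuclideanSpace ℝ (Fin n) → EuclideanSpace ℝ (Fin n)}
    {Df : EuclideanSpace ℝ (Fin n) → EuclideanSpace ℝ (Fin n) →L[ℝ] EuclideanSpace ℝ (Fin n)}
    {δ : ℝ} (hV : IsOpen V) (hVb : Bornology.IsBounded V) (hf : ContinuousOn f V)
    (hDf : HasWeakDerivOn f Df V) (hDfp : ∫⁻ x in V, ENNReal.ofReal (‖Df x‖ ^ p) < ⊤)
    (hE₀ : IsCompact E₀) (hE₀V : E₀ ⊆ V) (hcap : sobCap n s E₀ V = 0) (hU : IsOpen U)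
    (hK : IsCompact K) (hKU : K ⊆ U) (hδ : 0 < δ) (hE₀K : ∀ x ∈ E₀, closedBall (f x) δ ⊆ K) :
    sobCap n r (f '' E₀) U = 0 := by
  have hn0 : 0 < n := by omega
  have ha0 : 0 < a := by linarith
  have hq0 : 0 < q := by linarith
  have hs1 : 1 ≤ s := by nlinarith
  obtain ⟨C, hC, himage⟩ := exists_sobCap_image_le hn0 hr ha0 haq hq hσ hσe
  obtain ⟨CP, hCP⟩ := exists_lintegral_enorm_le_lintegral_fderiv hn hVb
  have hVfin : volume V ≠ ⊤ := hVb.measure_lt_top.ne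
  set M : ℝ≥0∞ := ENNReal.ofReal (3 ^ σ) *
    (1 + 2 * volume V + ∫⁻ y in V, ENNReal.ofReal (‖Df y‖ ^ p)) with hM
  have hMfin : M ≠ ⊤ := by
    refine ENNReal.mul_ne_top ENNReal.ofReal_ne_top ?_
    simp [hVfin, hDfp.ne, ENNReal.mul_eq_top]
  obtain ⟨ε, hε, hεV⟩ := hE₀.exists_cthickening_subset_open hV hE₀V
  have hlim : Tendsto (fun k : ℕ => 2 * ((n : ℝ) * (2 ^ k)⁻¹)) atTop (𝓝 0) := by
    simpa using (tendsto_inv_two_pow.const_mul (n : ℝ)).const_mul 2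
  obtain ⟨k₀, hk₀⟩ := eventually_atTop.1 ((hlim.eventually_le_const hε).and
    (eventually_three_mul_morreyConst_le (m := morreyConst n q) hq hq0
      (ENNReal.toReal_nonneg (a := M)) hδ))
  have hball : ∀ x ∈ E₀, closedBall x (2 * (n * (2 ^ k₀)⁻¹)) ⊆ V := fun x hx =>
    (closedBall_subset_closedBall (hk₀ k₀ le_rfl).1).trans
      ((closedBall_subset_cthickening hx ε).trans hεV)
  have hcell : ∀ x ∈ E₀, ∀ k ≥ k₀, dyadicCell k x ⊆ V := fun x hx k hk =>
    (dyadicCell_anti hk).trans (dyadicCell_subset_closedBall.trans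
      ((closedBall_subset_closedBall (by
        have : (0 : ℝ) ≤ n * (2 ^ k₀)⁻¹ := by positivity
        linarith)).trans (hball x hx)))
  set B : ℝ := CP * (volume.real V + 1) with hB
  have hB0 : 0 ≤ B := by positivity
  set c₀ : ℝ := 1 / (2 * (2 ^ n * n)) with hc₀
  have hc₀0 : 0 < c₀ := by
    have : (0 : ℝ) < n := by exact_mod_cast hn0
    positivity
  have key : ∀ τ : ℝ, 0 < τ → (2 ^ k₀) ^ n * (B * τ) ≤ 1 / 2 →
      sobCap n r (f '' E₀) U ≤ ENNReal.ofReal (C / (c₀ / τ) ^ r) * M := by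
    intro τ hτ hτB
    obtain ⟨u, hu, huV, ⟨W, hW, hEW, hW1⟩, hint⟩ :=
      exists_lintegral_fderiv_lt_of_sobCap_eq_zero hcap
        (ENNReal.ofReal_pos.2 (Real.rpow_pos_of_pos hτ s))
    have hu1 : ContDiff ℝ 1 u := hu.of_le (by simp)
    have hDu : Continuous (fderiv ℝ u) := hu1.continuous_fderiv one_ne_zero
    set G : EuclideanSpace ℝ (Fin n) → ℝ := fun y =>
      (‖fderiv ℝ u y‖ / τ) ^ a + 1 + ‖Df y‖ ^ q with hG
    have hG1 : ∀ y, 1 ≤ G y := fun y => by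
      have h1 : 0 ≤ (‖fderiv ℝ u y‖ / τ) ^ a := by positivity
      have h2 : 0 ≤ ‖Df y‖ ^ q := by positivity
      simp only [hG]; linarith
    have hG0 : ∀ y, 0 ≤ G y := fun y => zero_le_one.trans (hG1 y)
    have hGσ : ∫⁻ y in V, ENNReal.ofReal (G y ^ σ) ≤ M :=
      lintegral_weight_rpow_le (by linarith) hq0.le hτ haσ hqσ (fun y => norm_nonneg _)
        (fun y => norm_nonneg _) hDu.norm.measurable hint.le
    have hGM : ∫⁻ y in V, ENNReal.ofReal (G y) ≤ M := by
      refine (lintegral_mono fun y => ENNReal.ofReal_le_ofReal ?_).trans hGσ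
      exact Real.self_le_rpow_of_one_le (hG1 y) hσ.le
    have hGint : IntegrableOn G V := by
      refine ⟨?_, ?_⟩
      · have h1 : AEStronglyMeasurable Df (volume.restrict V) := hDf.1.aestronglyMeasurable
        have h2 : AEMeasurable (fun y => ‖Df y‖ ^ q) (volume.restrict V) :=
          h1.norm.aemeasurable.pow_const q
        have h3 : Measurable fun y => (‖fderiv ℝ u y‖ / τ) ^ a :=
          (hDu.norm.measurable.div_const τ).pow_const a
        exact ((h3.add_const 1).aemeasurable.add h2).aestronglyMeasurable
      · rw [hasFiniteIntegral_iff_ofReal (Eventually.of_forall hG0)]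
        exact hGM.trans_lt hMfin.lt_top
    have hDG : ∀ y ∈ V, ‖Df y‖ ≤ G y ^ (1 / q) := fun y _ => by
      calc ‖Df y‖ = (‖Df y‖ ^ q) ^ (1 / q) := by
            rw [← Real.rpow_mul (norm_nonneg _), mul_one_div_cancel hq0.ne', Real.rpow_one]
        _ ≤ G y ^ (1 / q) := by
            have h1 : 0 ≤ (‖fderiv ℝ u y‖ / τ) ^ a := by positivity
            gcongr
            simp only [hG]; linarith
    have hGu : ∀ y, ‖fderiv ℝ u y‖ ≤ τ * G y ^ (1 / a) := fun y => by
      calc ‖fderiv ℝ u y‖ = τ * ((‖fderiv ℝ u y‖ / τ) ^ a) ^ (1 / a) := by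
            rw [← Real.rpow_mul (by positivity), mul_one_div_cancel ha0.ne', Real.rpow_one]
            field_simp
        _ ≤ τ * G y ^ (1 / a) := by
            have h1 : 0 ≤ ‖Df y‖ ^ q := by positivity
            gcongr
            simp only [hG]; linarith
    have hu_int : ∫⁻ y, ‖u y‖ₑ ≤ ENNReal.ofReal (B * τ) := by
      refine (hCP u hu1 ((subset_tsupport u).trans huV)).trans ?_
      have h1 : ∫⁻ y, ‖fderiv ℝ u y‖ₑ = ∫⁻ y in V, ‖fderiv ℝ u y‖ₑ := by
        refine (setLIntegral_eq_of_support_subset fun y hy => ?_).symm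
        refine huV (support_fderiv_subset ℝ ?_)
        exact fun h => hy (by
          beta_reduce
          rw [h, ← ofReal_norm, norm_zero, ENNReal.ofReal_zero])
      have h2 : ∀ y, ‖fderiv ℝ u y‖ₑ ≤ ENNReal.ofReal τ *
          (1 + ENNReal.ofReal ((τ ^ s)⁻¹) * ENNReal.ofReal (‖fderiv ℝ u y‖ ^ s)) := fun y => by
        rw [← ofReal_norm, ← ENNReal.ofReal_one, ← ENNReal.ofReal_mul (by positivity),
          ← ENNReal.ofReal_add (by positivity) (by positivity),
          ← ENNReal.ofReal_mul (by positivity)]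
        refine ENNReal.ofReal_le_ofReal ?_
        have h3 := le_one_add_rpow (t := ‖fderiv ℝ u y‖ / τ) (by positivity) hs1
        rw [Real.div_rpow (norm_nonneg _) hτ.le, div_le_iff₀ hτ] at h3
        rw [inv_mul_eq_div]
        linarith
      have h3 : ∫⁻ y in V, ‖fderiv ℝ u y‖ₑ ≤ ENNReal.ofReal τ * (volume V + 1) := by
        refine (lintegral_mono h2).trans ?_
        rw [lintegral_const_mul' _ _ ENNReal.ofReal_ne_top, lintegral_add_left measurable_const,
          lintegral_const_mul' _ _ ENNReal.ofReal_ne_top, setLIntegral_const, one_mul]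
        gcongr
        calc ENNReal.ofReal ((τ ^ s)⁻¹) * ∫⁻ y in V, ENNReal.ofReal (‖fderiv ℝ u y‖ ^ s)
            ≤ ENNReal.ofReal ((τ ^ s)⁻¹) * ENNReal.ofReal (τ ^ s) := by gcongr
          _ = 1 := by
            rw [← ENNReal.ofReal_mul (by positivity), inv_mul_cancel₀ (by positivity),
              ENNReal.ofReal_one]
      rw [h1]
      calc (CP : ℝ≥0∞) * ∫⁻ y in V, ‖fderiv ℝ u y‖ₑ
          ≤ CP * (ENNReal.ofReal τ * (volume V + 1)) := by gcongr
        _ = ENNReal.ofReal (B * τ) := by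
          rw [← ENNReal.ofReal_coe_nnreal, ← ENNReal.ofReal_toReal hVfin, ← ENNReal.ofReal_one,
            ← ENNReal.ofReal_add (by positivity) (by positivity),
            ← ENNReal.ofReal_mul (by positivity), ← ENNReal.ofReal_mul (by positivity)]
          congr 1
          simp only [hB, Measure.real]
          ring
    obtain ⟨N, hN⟩ := exists_le_sum_cellWeight hn0 ha hτ k₀ hE₀ hW hEW hu1 hW1 hG0
      (fun x hx => hGint.mono_set (hcell x hx k₀ le_rfl)) hGu
      (fun x _ => (abs_cellAvg_le (by positivity) hu_int).trans hτB)
    refine (himage V U K E₀ f Df G k₀ N (c₀ / τ) δ hV hf hDf hGint hG1 hDG hU hK hKU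
      hE₀.isBounded hball hE₀K (fun x hx k hk => ?_) (by positivity) hN).trans (by gcongr)
    refine le_trans ?_ (hk₀ k hk).2
    have h1 : cellAvg k x G ≤ (2 ^ k) ^ n * M.toReal := by
      have h2 := ofReal_cellAvg (hGint.mono_set (hcell x hx k hk)) hG0
      rw [← ENNReal.ofReal_le_ofReal_iff (by positivity), h2, ENNReal.ofReal_mul (by positivity),
        ENNReal.ofReal_toReal hMfin]
      gcongr
      exact (lintegral_mono_set (hcell x hx k hk)).trans hGM
    have h3 : 0 ≤ cellAvg k x G := by
      rw [cellAvg, smul_eq_mul]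
      exact mul_nonneg (by positivity) (integral_nonneg hG0)
    have := (morreyConst_pos hn0 hq).le
    gcongr
  have hlim0 : Tendsto (fun τ : ℝ => ENNReal.ofReal (C / (c₀ / τ) ^ r) * M) (𝓝[>] 0) (𝓝 0) := by
    have h1 : Tendsto (fun τ : ℝ => C / c₀ ^ r * τ ^ r) (𝓝[>] 0) (𝓝 0) := by
      have : Tendsto (fun τ : ℝ => C / c₀ ^ r * τ ^ r) (𝓝 0) (𝓝 (C / c₀ ^ r * 0 ^ r)) :=
        ((Real.continuous_rpow_const hr.le).tendsto 0).const_mul _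
      rw [Real.zero_rpow hr.ne', mul_zero] at this
      exact this.mono_left nhdsWithin_le_nhds
    have h2 : Tendsto (fun τ : ℝ => C / (c₀ / τ) ^ r) (𝓝[>] 0) (𝓝 0) := by
      refine h1.congr' ?_
      filter_upwards [self_mem_nhdsWithin] with τ hτ
      have hτ' : 0 < τ := hτ
      rw [Real.div_rpow hc₀0.le hτ'.le]
      field_simp
    have h3 := ENNReal.Tendsto.mul_const (ENNReal.tendsto_ofReal h2) (Or.inr hMfin)
    simpa using h3
  refine le_antisymm (ge_of_tendsto hlim0 ?_) zero_le
  have hev : ∀ᶠ τ : ℝ in 𝓝[>] 0, (2 ^ k₀) ^ n * (B * τ) ≤ 1 / 2 := by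
    have : Tendsto (fun τ : ℝ => (2 ^ k₀) ^ n * (B * τ)) (𝓝 0) (𝓝 ((2 ^ k₀) ^ n * (B * 0))) :=
      ((continuous_id.const_mul B).const_mul _).tendsto 0
    rw [mul_zero, mul_zero] at this
    exact (this.mono_left nhdsWithin_le_nhds).eventually_le_const (by norm_num)
  filter_upwards [self_mem_nhdsWithin, hev] with τ hτ h using key τ hτ h

/-- Auxiliary exponents for the distortion of capacity. -/
theorem exists_capacity_exponents {ν r s p : ℝ} (hr : 1 ≤ r) (hsν : s < ν) (hp : ν < p)
    (hs : 0 < s) (hrs : r ≤ s * (p - ν) / (p - s)) :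
    ∃ a q σ : ℝ, 1 ≤ a ∧ a < q ∧ ν < q ∧ 1 < σ ∧ r / a + (ν - r) / q = σ ∧ a * σ = s ∧
      q * σ ≤ p := by
  have hps : 0 < p - s := by linarith
  rw [le_div_iff₀ hps] at hrs
  have hrs' : r < s := by nlinarith
  have hsr : 0 < s - r := by linarith
  have hs1 : 1 < s := by linarith
  have hν : 0 < ν := by linarith
  have hνr : 0 < ν - r := by linarith
  set P := s * (ν - r) / (s - r) with hP
  have hνP : ν < P := by
    rw [hP, lt_div_iff₀ hsr]; nlinarith
  have hPp : P ≤ p := by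
    rw [hP, div_le_iff₀ hsr]; nlinarith
  have hP0 : 0 < P := by linarith
  have h1 : 1 < min s (P / ν) := lt_min hs1 ((one_lt_div hν).2 hνP)
  obtain ⟨σ, hσ1, hσ⟩ := exists_between h1
  have hσs : σ < s := hσ.trans_le (min_le_left _ _)
  have hσP : σ < P / ν := hσ.trans_le (min_le_right _ _)
  have hσ0 : 0 < σ := by linarith
  refine ⟨s / σ, P / σ, σ, (one_le_div hσ0).2 hσs.le, ?_, ?_, hσ1, ?_, ?_, ?_⟩
  · gcongr; linarith
  · rw [lt_div_iff₀ hσ0]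
    rw [lt_div_iff₀ hν] at hσP
    linarith
  · rw [hP]
    field_simp
    ring
  · field_simp
  · rw [div_mul_cancel₀ _ hσ0.ne']; exact hPp

/-- Iwaniec–Martin: quasiconformal distortion of Sobolev capacity. -/
theorem qc_capacity_distortion (n : ℕ) (hn : 2 ≤ n)
    (Ω Ω' : Set (EuclideanSpace ℝ (Fin n)))
    (f : EuclideanSpace ℝ (Fin n) → EuclideanSpace ℝ (Fin n))
    (hΩ : IsEuclDomain Ω) (hΩ' : IsEuclDomain Ω')
    (K : ℝ) (hK : 1 ≤ K) (hf : IsQCHomeoOn K f Ω Ω')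
    (p : ℝ) (hp : (n : ℝ) < p) (hfp : MemW1pLoc n n p Ω f)
    (E : Set (EuclideanSpace ℝ (Fin n))) (hEΩ : E ⊆ Ω)
    (hEclosed : ∃ C, IsClosed C ∧ E = C ∩ Ω)
    (s : ℝ) (hs0 : 0 < s) (hsn : s < n) (hvan : VanishingCap n s E Ω) :
    ∀ r : ℝ, 0 < r → r ≤ s*(p - n)/(p - s) → VanishingCap n r (f '' E) Ω' := by
  intro r hr hrs F hFE hF U hU hUΩ hFU
  rcases lt_or_ge r 1 with hr1 | hr1
  · exact sobCap_eq_zero_of_lt_one hr hr1 hF hU hFU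
  obtain ⟨⟨hbij, hfc, g, hg, hgc⟩, -⟩ := hf
  obtain ⟨a, q, σ, ha, haq, hq, hσ, hσe, haσ, hqσ⟩ :=
    exists_capacity_exponents hr1 hsn hp hs0 hrs
  set E₀ := g '' F with hE₀_def
  have hE₀ : IsCompact E₀ := hF.image_of_continuousOn (hgc.mono (hFU.trans hUΩ))
  have hE₀E : E₀ ⊆ E := by
    rintro _ ⟨y, hy, rfl⟩
    obtain ⟨x, hx, rfl⟩ := hFE hy
    rwa [hg.1 (hEΩ hx)]
  have hfE₀ : f '' E₀ = F := by
    rw [hE₀_def, image_image]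
    refine (image_congr fun y hy => ?_).trans (image_id F)
    exact hg.2 (hUΩ (hFU hy))
  obtain ⟨V, hV, hE₀V, hVΩ, hVc⟩ :=
    exists_open_between_and_isCompact_closure hE₀ hΩ.1 (hE₀E.trans hEΩ)
  obtain ⟨Df, hDf, hDfp, hweak⟩ := hfp V hV hVc hVΩ
  obtain ⟨δ, hδ, hFδ⟩ := hF.exists_cthickening_subset_open hU hFU
  rw [← hfE₀]
  refine sobCap_image_eq_zero hn hr ha haq hq hσ hσe haσ hqσ hV
    (hVc.isBounded.subset subset_closure) (hfc.mono (subset_closure.trans hVΩ)) ⟨hDf, hweak⟩ hDfp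
    hE₀ hE₀V (hvan E₀ hE₀E hE₀ V hV (subset_closure.trans hVΩ) hE₀V) hU (hF.cthickening (r := δ))
    hFδ hδ fun x hx => closedBall_subset_cthickening ?_ δ
  rw [← hfE₀]
  exact mem_image_of_mem f hx
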